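/- (Key level-set inequality in the proof of Theorem B(b)) Let u be a weak stationary solution density and let U be a weak anti-Lyapunov function in 𝒰 with respect to ℒ with essential lower bound ρ_m and essential upper bound ρ_M. Let h, H be sandwich functions for U with h continuous and positive on [ρ_m, ρ_M) (note that h > 0 forces ∇U(x) ≠ 0 whenever U(x) ∈ [ρ_m, ρ_M)). Define H̃(ρ) = H(ρ) ∫_{ρ_m}^{ρ} ds / h(s). Then for every ρ ∈ (ρ_m, ρ_M), μ(Ω_ρ \ Ω_{ρ_m}) ≤ H̃(ρ) · ∫_{U^{-1}(ρ)} u(x)/|∇U(x)| dℋ^{n−1}(x), where ℋ^{n−1} is the (n−1)-dimensional Hausdorff measure. -/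

import Mathlib

open MeasureTheory

noncomputable section

/-- Euclidean space ℝⁿ. -/
abbrev Eucl (n : ℕ) : Type := EuclideanSpace ℝ (Fin n)

/-- First-order partial derivative `∂ᵢ f`. -/
def pd {n : ℕ} (f : Eucl n → ℝ) (i : Fin n) (x : Eucl n) : ℝ :=
  fderiv ℝ f x (EuclideanSpace.single i 1)

/-- Second-order partial derivative `∂²ᵢⱼ f`. -/
def pd2 {n : ℕ} (f : Eucl n → ℝ) (i j : Fin n) (x : Eucl n) : ℝ :=
  fderiv ℝ (fun y => fderiv ℝ f y (EuclideanSpace.single j 1)) x (EuclideanSpace.single i 1)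

/-- The adjoint Fokker–Planck operator `ℒf = aⁱʲ ∂²ᵢⱼ f + Vⁱ ∂ᵢ f`. -/
def Lop {n : ℕ} (a : Eucl n → Matrix (Fin n) (Fin n) ℝ)
    (V : Eucl n → Fin n → ℝ) (f : Eucl n → ℝ) (x : Eucl n) : ℝ :=
  (∑ i, ∑ j, a x i j * pd2 f i j x) + ∑ i, V x i * pd f i x

/-- The quadratic form `⟨a(x) ∇f(x), ∇f(x)⟩ = ∑ᵢⱼ aⁱʲ ∂ᵢf ∂ⱼf`. -/
def aQuad {n : ℕ} (a : Eucl n → Matrix (Fin n) (Fin n) ℝ)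
    (f : Eucl n → ℝ) (x : Eucl n) : ℝ :=
  ∑ i, ∑ j, a x i j * pd f i x * pd f j x

/-- Orthonormal coordinates on `ℝ^{k+1}` whose first axis points along the unit vector `e`. -/
structure AxisCoords {k : ℕ} (e : Eucl (k + 1)) where
  /-- The parametrization `(s, y) ↦ s e + y`. -/
  param : ℝ × (Fin k → ℝ) → Eucl (k + 1)
  /-- The projection along `e`. -/
  proj : Eucl (k + 1) → (Fin k → ℝ)
  measurePreserving : MeasurePreserving param
  param_eq : ∀ s t y, param (s, y) = param (t, y) + (s - t) • e
  lipschitz_proj : LipschitzWith 1 proj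
  proj_param : ∀ s y, proj (param (s, y)) = y
  norm_sub_le : ∀ x y, ‖x - y‖ ≤ |inner ℝ e (x - y)| + k * ‖proj x - proj y‖

theorem AxisCoords.nonempty {k : ℕ} (e : Eucl (k + 1)) (he : ‖e‖ = 1) :
    Nonempty (AxisCoords e) := by
  obtain ⟨b, hb⟩ := Orthonormal.exists_orthonormalBasis_extension_of_card_eq
    (𝕜 := ℝ) (E := Eucl (k + 1)) (ι := Fin (k + 1)) (by simp) (v := fun _ => e) (s := {0})
    (by
      refine ⟨fun i => by simpa using he, fun i j hij => ?_⟩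
      exact absurd (Subtype.ext (i.2.trans j.2.symm)) hij)
  have hb0 : b 0 = e := hb 0 rfl
  have hrepr : ∀ (s : ℝ) (y : Fin k → ℝ),
      b.repr.symm (WithLp.toLp 2 (Fin.cons s y)) = s • e + ∑ i, y i • b i.succ := by
    intro s y
    rw [← OrthonormalBasis.sum_repr_symm, Fin.sum_univ_succ]
    simp [hb0]
  have hin : ∀ x : Eucl (k + 1), x = inner ℝ e x • e + ∑ i : Fin k, inner ℝ (b i.succ) x • b i.succ := by
    intro x
    conv_lhs => rw [← b.sum_repr' x]
    rw [Fin.sum_univ_succ, hb0]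
  refine ⟨⟨fun p => b.repr.symm (WithLp.toLp 2 (Fin.cons p.1 p.2)),
    fun x i => inner ℝ (b i.succ) x, ?_, ?_, ?_, ?_, ?_⟩⟩
  · have h1 := (volume_preserving_piFinSuccAbove (fun _ : Fin (k + 1) => ℝ) 0).symm
    have h2 := b.measurePreserving_repr_symm.comp
      ((PiLp.volume_preserving_toLp (Fin (k + 1))).comp h1)
    have h3 : (fun p : ℝ × (Fin k → ℝ) => b.repr.symm (WithLp.toLp 2 (Fin.cons p.1 p.2))) =
        b.repr.symm ∘ WithLp.toLp 2 ∘
          (MeasurableEquiv.piFinSuccAbove (fun _ : Fin (k + 1) => ℝ) 0).symm := by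
      funext p
      simp [MeasurableEquiv.piFinSuccAbove, Fin.consEquiv]
    rw [h3]
    exact h2
  · intro s t y
    simp only [hrepr]
    module
  · refine LipschitzWith.of_dist_le_mul fun x y => ?_
    rw [NNReal.coe_one, one_mul, dist_pi_le_iff dist_nonneg]
    intro i
    rw [Real.dist_eq, ← inner_sub_right, dist_eq_norm]
    simpa using abs_real_inner_le_norm (b i.succ) (x - y)
  · intro s y
    funext i
    have : (WithLp.toLp 2 (Fin.cons s y) : Eucl (k+1)) i.succ = y i := by simp
    rw [← this, ← b.repr_apply_apply, LinearIsometryEquiv.apply_symm_apply]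
  · intro x y
    conv_lhs => rw [hin (x - y)]
    refine (norm_add_le _ _).trans ?_
    gcongr
    · simp [norm_smul, he]
    · refine (norm_sum_le _ _).trans ?_
      calc ∑ i : Fin k, ‖inner ℝ (b i.succ) (x - y) • b i.succ‖
          ≤ ∑ i : Fin k, ‖(fun i : Fin k => inner ℝ (b i.succ) x)
              - fun i : Fin k => inner ℝ (b i.succ) y‖ := by
            refine Finset.sum_le_sum fun i _ => ?_
            rw [norm_smul, b.norm_eq_one, mul_one, inner_sub_right]
            exact norm_le_pi_norm ((fun i : Fin k => inner ℝ (b i.succ) x)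
              - fun i : Fin k => inner ℝ (b i.succ) y) i
        _ = _ := by simp

theorem ContinuousOn.measurableSet_inter_preimage {X : Type*} [TopologicalSpace X]
    [MeasurableSpace X] [OpensMeasurableSpace X] {U : X → ℝ} {N : Set X} (hU : ContinuousOn U N)
    (hN : MeasurableSet N) {A : Set ℝ} (hA : MeasurableSet A) : MeasurableSet (N ∩ U ⁻¹' A) := by
  have := hN.subtype_image (hU.domRestrict.measurable hA)
  rwa [Set.domRestrict_eq, Set.preimage_comp, Subtype.image_preimage_coe] at this

/-- `U` differs from the linear function `g ⟪e, ·⟫` by at most `c`-Lipschitz errors on `N`,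
where `c` is at most half of the slope `g`. -/
structure NearlyLinearOn {n : ℕ} (U : Eucl n → ℝ) (e : Eucl n) (g c : ℝ) (N : Set (Eucl n)) :
    Prop where
  slope_pos : 0 < g
  err_nonneg : 0 ≤ c
  two_mul_err_le : 2 * c ≤ g
  abs_sub_le : ∀ x ∈ N, ∀ y ∈ N, |U x - U y - g * inner ℝ e (x - y)| ≤ c * ‖x - y‖

theorem NearlyLinearOn.norm_sub_le_of_eq {k : ℕ} {U : Eucl (k + 1) → ℝ} {e : Eucl (k + 1)}
    {g c : ℝ} {N : Set (Eucl (k + 1))} (hN : NearlyLinearOn U e g c N) (C : AxisCoords e)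
    {x y : Eucl (k + 1)} (hx : x ∈ N) (hy : y ∈ N) (hxy : U x = U y) :
    ‖x - y‖ ≤ 2 * k * ‖C.proj x - C.proj y‖ := by
  have h1 := hN.abs_sub_le x hx y hy
  have h2 := C.norm_sub_le x y
  have hg := hN.slope_pos
  rw [hxy, sub_self, zero_sub, abs_neg, abs_mul, abs_of_pos hg] at h1
  have h3 : g * |inner ℝ e (x - y)| ≤ g * (‖x - y‖ / 2) := by
    nlinarith [hN.two_mul_err_le, norm_nonneg (x - y)]
  have h4 := le_of_mul_le_mul_left h3 hg
  linarith

theorem NearlyLinearOn.injOn_proj {k : ℕ} {U : Eucl (k + 1) → ℝ} {e : Eucl (k + 1)}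
    {g c : ℝ} {N : Set (Eucl (k + 1))} (hN : NearlyLinearOn U e g c N) (C : AxisCoords e) (ρ : ℝ) :
    Set.InjOn C.proj (N ∩ {x | U x = ρ}) := by
  intro x hx y hy hxy
  have := hN.norm_sub_le_of_eq C hx.1 hy.1 (hx.2.trans hy.2.symm)
  rw [hxy, sub_self, norm_zero, mul_zero] at this
  exact sub_eq_zero.1 (norm_le_zero_iff.1 this)

theorem NearlyLinearOn.hausdorffMeasure_lt_top {k : ℕ} {U : Eucl (k + 1) → ℝ} {e : Eucl (k + 1)}
    {g c : ℝ} {N : Set (Eucl (k + 1))} (hN : NearlyLinearOn U e g c N) (C : AxisCoords e)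
    (hb : Bornology.IsBounded N) (ρ : ℝ) : μH[(k : ℝ)] (N ∩ {x | U x = ρ}) < ⊤ := by
  set S := N ∩ {x | U x = ρ} with hS
  set G := Function.invFunOn C.proj S
  have hG : ∀ y ∈ C.proj '' S, G y ∈ S ∧ C.proj (G y) = y := fun y hy =>
    ⟨Function.invFunOn_mem hy, Function.invFunOn_eq hy⟩
  have hLip : LipschitzOnWith (2 * k : NNReal) G (C.proj '' S) := by
    refine LipschitzOnWith.of_dist_le_mul fun y hy z hz => ?_
    have := hN.norm_sub_le_of_eq C (hG y hy).1.1 (hG z hz).1.1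
      ((hG y hy).1.2.trans (hG z hz).1.2.symm)
    rw [(hG y hy).2, (hG z hz).2] at this
    simpa [dist_eq_norm] using this
  have himg : S ⊆ G '' (C.proj '' S) := fun x hx =>
    ⟨C.proj x, ⟨x, hx, rfl⟩, hN.injOn_proj C ρ (hG _ ⟨x, hx, rfl⟩).1 hx (hG _ ⟨x, hx, rfl⟩).2⟩
  have hvol : (μH[(k : ℝ)] : Measure (Fin k → ℝ)) = volume := by
    simpa using hausdorffMeasure_pi_real (ι := Fin k)
  have hbd : volume (C.proj '' S) < ⊤ :=
    (C.lipschitz_proj.isBounded_image (hb.subset Set.inter_subset_left)).measure_lt_top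
  calc μH[(k : ℝ)] S ≤ μH[(k : ℝ)] (G '' (C.proj '' S)) := measure_mono himg
    _ ≤ _ := hLip.hausdorffMeasure_image_le (Nat.cast_nonneg k)
    _ < ⊤ := by
      rw [hvol]
      exact ENNReal.mul_lt_top (ENNReal.rpow_lt_top_of_nonneg (Nat.cast_nonneg k) (by finiteness)) hbd

theorem AxisCoords.restrict_volume_le {k : ℕ} {e : Eucl (k + 1)} (C : AxisCoords e)
    (S : Set (Eucl (k + 1))) :
    (volume : Measure (Fin k → ℝ)).restrict (C.proj '' S) ≤
      (μH[(k : ℝ)].restrict S).map C.proj := by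
  have hvol : (μH[(k : ℝ)] : Measure (Fin k → ℝ)) = volume := by
    simpa using hausdorffMeasure_pi_real (ι := Fin k)
  have hmeas := C.lipschitz_proj.continuous.measurable
  refine Measure.le_iff.2 fun A hA => ?_
  rw [Measure.restrict_apply hA, Measure.map_apply hmeas hA, Measure.restrict_apply (hmeas hA),
    ← hvol]
  refine le_trans (measure_mono ?_) ((C.lipschitz_proj.hausdorffMeasure_image_le
    (Nat.cast_nonneg k) (C.proj ⁻¹' A ∩ S)).trans (by simp))
  rintro _ ⟨hy, x, hx, rfl⟩
  exact ⟨x, ⟨hy, hx⟩, rfl⟩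

theorem NearlyLinearOn.abs_sub_le_of_axis {n : ℕ} {U : Eucl n → ℝ} {e : Eucl n} (he : ‖e‖ = 1)
    {g c : ℝ} {N : Set (Eucl n)} (hN : NearlyLinearOn U e g c N) {x : Eucl n} {t : ℝ}
    (hx : x ∈ N) (hy : x + t • e ∈ N) : |U (x + t • e) - U x - g * t| ≤ c * |t| := by
  have := hN.abs_sub_le _ hy _ hx
  simpa [norm_smul, inner_smul_right, he] using this

/-- Moving down along the axis from a point of the slab `ρ ≤ U < ρ + ε` one reaches `U = ρ`. -/
theorem NearlyLinearOn.exists_level {n : ℕ} {U : Eucl n → ℝ} {e : Eucl n} (he : ‖e‖ = 1)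
    {g c : ℝ} {N : Set (Eucl n)} (hN : NearlyLinearOn U e g c N) (hUc : ContinuousOn U N)
    {x : Eucl n} {d ε ρ : ℝ} (hd : ε / (g - c) ≤ d)
    (hball : Metric.closedBall x d ⊆ N) (hε : 0 < ε) (h1 : ρ ≤ U x) (h2 : U x < ρ + ε) :
    ∃ t : ℝ, |t| ≤ d ∧ x + t • e ∈ N ∧ U (x + t • e) = ρ := by
  have hgc : 0 < g - c := by linarith [hN.slope_pos, hN.err_nonneg, hN.two_mul_err_le]
  set r := ε / (g - c) with hr
  have hr0 : 0 < r := div_pos hε hgc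
  have hmem : ∀ t ∈ Set.Icc (-r) 0, x + t • e ∈ N := fun t ht => hball (by
    rw [Metric.mem_closedBall, dist_eq_norm, add_sub_cancel_left, norm_smul, he, mul_one,
      Real.norm_eq_abs]
    exact (abs_le.2 ⟨ht.1, ht.2.trans hr0.le⟩).trans hd)
  have hcont : ContinuousOn (fun t : ℝ => U (x + t • e)) (Set.Icc (-r) 0) :=
    hUc.comp (by fun_prop) hmem
  have hx : x ∈ N := by simpa using hmem 0 ⟨by linarith, le_refl _⟩
  have hlow : U (x + (-r) • e) ≤ ρ := by
    have h3 := (abs_le.1 (hN.abs_sub_le_of_axis he hx (hmem (-r) ⟨le_refl _, by linarith⟩))).2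
    rw [abs_neg, abs_of_pos hr0] at h3
    have : (g - c) * r = ε := by rw [hr]; field_simp
    linarith
  obtain ⟨t, ht, hUt⟩ := intermediate_value_Icc (by linarith) hcont ⟨hlow, by simpa using h1⟩
  exact ⟨t, (abs_le.2 ⟨ht.1, ht.2.trans hr0.le⟩).trans hd, hmem t ht, hUt⟩

/-- The part of a slab on a line parallel to the axis is short. -/
theorem NearlyLinearOn.volume_fiber_le {k : ℕ} {U : Eucl (k + 1) → ℝ} {e : Eucl (k + 1)}
    (he : ‖e‖ = 1) {g c : ℝ} {N : Set (Eucl (k + 1))} (hN : NearlyLinearOn U e g c N)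
    (C : AxisCoords e) (ρ ε : ℝ) (y : Fin k → ℝ) :
    volume {s : ℝ | C.param (s, y) ∈ {x ∈ N | ρ ≤ U x ∧ U x < ρ + ε}} ≤
      ENNReal.ofReal (ε / (g - c)) := by
  have hgc : 0 < g - c := by linarith [hN.slope_pos, hN.err_nonneg, hN.two_mul_err_le]
  refine (Real.volume_le_diam _).trans (Metric.ediam_le fun s hs t ht => ?_)
  rw [edist_dist]
  refine ENNReal.ofReal_le_ofReal ?_
  rw [le_div_iff₀ hgc, Real.dist_eq]
  obtain ⟨hs1, hs2, hs3⟩ := hs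
  obtain ⟨ht1, ht2, ht3⟩ := ht
  rw [C.param_eq s t] at hs1 hs2 hs3
  have := abs_le.1 (hN.abs_sub_le_of_axis he ht1 hs1)
  rcases abs_cases (s - t) with ⟨h, _⟩ | ⟨h, _⟩ <;> rw [h] at this ⊢ <;> nlinarith [this.1, this.2]

/-- The mass of a slab is controlled by the integral over the level set. -/
theorem NearlyLinearOn.lintegral_slab_le {k : ℕ} {U : Eucl (k + 1) → ℝ} {e : Eucl (k + 1)}
    (he : ‖e‖ = 1) {g c : ℝ} {N : Set (Eucl (k + 1))} (hN : NearlyLinearOn U e g c N)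
    (hNo : IsOpen N) (hUc : ContinuousOn U N) (C : AxisCoords e) {f : Eucl (k + 1) → ℝ}
    (hf : Continuous f) {K : Set (Eucl (k + 1))} (hK : IsCompact K) (hfK : ∀ x, x ∉ K → f x = 0)
    {d ω : ℝ} (hdN : ∀ x ∈ K, Metric.closedBall x d ⊆ N)
    (hω : ∀ x y, dist x y ≤ d → f x ≤ f y + ω) {ρ ε : ℝ} (hε : 0 < ε) (hεd : ε / (g - c) ≤ d) :
    ∫⁻ x in {x ∈ N | ρ ≤ U x ∧ U x < ρ + ε}, ENNReal.ofReal (f x) ≤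
      ENNReal.ofReal (ε / (g - c)) * (∫⁻ x in N ∩ {x | U x = ρ}, ENNReal.ofReal (f x) ∂μH[(k : ℝ)]
        + ENNReal.ofReal ω * volume (C.proj '' K)) := by
  have hgc : 0 < g - c := by linarith [hN.slope_pos, hN.err_nonneg, hN.two_mul_err_le]
  set T := {x ∈ N | ρ ≤ U x ∧ U x < ρ + ε} with hT
  have hTm : MeasurableSet T :=
    hUc.measurableSet_inter_preimage hNo.measurableSet (measurableSet_Ico (a := ρ) (b := ρ + ε))
  set S := N ∩ {x | U x = ρ} with hS
  have hSm : MeasurableSet S :=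
    hUc.measurableSet_inter_preimage hNo.measurableSet (measurableSet_singleton ρ)
  set G := Function.invFunOn C.proj S
  set D := C.proj '' S with hD
  have hDm : MeasurableSet D := hSm.image_of_continuousOn_injOn
    C.lipschitz_proj.continuous.continuousOn (hN.injOn_proj C ρ)
  have hG : ∀ x ∈ S, G (C.proj x) = x := fun x hx =>
    hN.injOn_proj C ρ (Function.invFunOn_mem ⟨x, hx, rfl⟩) hx (Function.invFunOn_eq ⟨x, hx, rfl⟩)
  set F : (Fin k → ℝ) → ENNReal := D.indicator fun y => ENNReal.ofReal (f (G y))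
  set W : (Fin k → ℝ) → ENNReal := (C.proj '' K).indicator fun _ => ENNReal.ofReal ω
  have hKm : MeasurableSet (C.proj '' K) :=
    (hK.image C.lipschitz_proj.continuous).measurableSet
  have hWm : Measurable W := measurable_const.indicator hKm
  have hpt : ∀ s y, C.param (s, y) ∈ T → ENNReal.ofReal (f (C.param (s, y))) ≤ F y + W y := by
    intro s y hs
    set x := C.param (s, y) with hx
    have hxy : C.proj x = y := C.proj_param s y
    by_cases hxK : x ∈ K
    · obtain ⟨t, ht, htN, htU⟩ := hN.exists_level he hUc hεd (hdN x hxK) hε hs.2.1 hs.2.2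
      have hmem : x + t • e ∈ S := ⟨htN, htU⟩
      have hproj : C.proj (x + t • e) = y := by
        have := C.param_eq (s + t) s y
        rw [add_sub_cancel_left, ← hx] at this
        rw [← this, C.proj_param]
      have hyD : y ∈ D := ⟨_, hmem, hproj⟩
      have hyK : y ∈ C.proj '' K := ⟨x, hxK, hxy⟩
      simp only [F, W, Set.indicator_of_mem hyD, Set.indicator_of_mem hyK]
      rw [← hproj, hG _ hmem]
      refine (ENNReal.ofReal_le_ofReal (hω x (x + t • e) ?_)).trans ENNReal.ofReal_add_le
      rwa [dist_eq_norm, sub_add_cancel_left, norm_neg, norm_smul, he, mul_one]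
    · simp [hfK x hxK]
  have hfib : ∀ y, ∫⁻ s, T.indicator (fun x => ENNReal.ofReal (f x)) (C.param (s, y)) ≤
      ENNReal.ofReal (ε / (g - c)) * (F y + W y) := by
    intro y
    have hTy : MeasurableSet {s : ℝ | C.param (s, y) ∈ T} :=
      (C.measurePreserving.measurable.comp measurable_prodMk_right) hTm
    calc ∫⁻ s, T.indicator (fun x => ENNReal.ofReal (f x)) (C.param (s, y))
        ≤ ∫⁻ s, {s : ℝ | C.param (s, y) ∈ T}.indicator (fun _ => F y + W y) s := by
          refine lintegral_mono fun s => ?_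
          by_cases hs : C.param (s, y) ∈ T
          · rw [Set.indicator_of_mem hs, Set.indicator_of_mem (by exact hs)]
            exact hpt s y hs
          · simp [Set.indicator_of_notMem hs]
      _ = (F y + W y) * volume {s : ℝ | C.param (s, y) ∈ T} := by
          rw [lintegral_indicator hTy, setLIntegral_const]
      _ ≤ _ := by
          rw [mul_comm]
          gcongr
          exact hN.volume_fiber_le he C ρ ε y
  have hmeas : Measurable (T.indicator fun x => ENNReal.ofReal (f x)) :=
    (hf.measurable.ennreal_ofReal).indicator hTm
  have hF : ∫⁻ y, F y ≤ ∫⁻ x in S, ENNReal.ofReal (f x) ∂μH[(k : ℝ)] := by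
    rw [lintegral_indicator hDm]
    calc ∫⁻ y in D, ENNReal.ofReal (f (G y))
        ≤ ∫⁻ y, ENNReal.ofReal (f (G y)) ∂(μH[(k : ℝ)].restrict S).map C.proj :=
          lintegral_mono' (C.restrict_volume_le S) le_rfl
      _ ≤ ∫⁻ x in S, ENNReal.ofReal (f (G (C.proj x))) ∂μH[(k : ℝ)] := lintegral_map_le _ _
      _ = _ := setLIntegral_congr_fun hSm fun x hx => by simp only [hG x hx]
  calc ∫⁻ x in T, ENNReal.ofReal (f x)
      = ∫⁻ p, T.indicator (fun x => ENNReal.ofReal (f x)) (C.param p) := by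
        rw [C.measurePreserving.lintegral_comp hmeas, lintegral_indicator hTm]
    _ = ∫⁻ y, ∫⁻ s, T.indicator (fun x => ENNReal.ofReal (f x)) (C.param (s, y)) :=
        lintegral_prod_symm _ (hmeas.comp C.measurePreserving.measurable).aemeasurable
    _ ≤ ∫⁻ y, ENNReal.ofReal (ε / (g - c)) * (F y + W y) := lintegral_mono hfib
    _ = ENNReal.ofReal (ε / (g - c)) * ((∫⁻ y, F y) + ∫⁻ y, W y) := by
        rw [lintegral_const_mul' _ _ ENNReal.ofReal_ne_top, lintegral_add_right _ hWm]
    _ ≤ _ := by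
        rw [lintegral_indicator hKm, setLIntegral_const]
        gcongr

theorem exists_nearlyLinearOn {n : ℕ} {U : Eucl n → ℝ} {p : Eucl n}
    (hU : ContDiffAt ℝ 1 U p) (hp : fderiv ℝ U p ≠ 0) {W : Set (Eucl n)} (hW : W ∈ nhds p) {θ : ℝ} (hθ : 0 < θ) (hθ' : θ ≤ 1 / 2) :
    ∃ N e, IsOpen N ∧ p ∈ N ∧ N ⊆ W ∧ Bornology.IsBounded N ∧ ‖e‖ = 1 ∧ ContinuousOn U N ∧
      NearlyLinearOn U e ‖fderiv ℝ U p‖ (θ * ‖fderiv ℝ U p‖) N ∧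
      ∀ x ∈ N, |‖fderiv ℝ U x‖ - ‖fderiv ℝ U p‖| ≤ θ * ‖fderiv ℝ U p‖ := by
  set g := ‖fderiv ℝ U p‖ with hg
  have hg0 : 0 < g := norm_pos_iff.2 hp
  have hc0 : 0 < θ * g := mul_pos hθ hg0
  have hstrict := hU.hasStrictFDerivAt one_ne_zero
  obtain ⟨s, hs, hsl⟩ := hstrict.approximates_deriv_on_nhds
    (c := ⟨θ * g, hc0.le⟩) (Or.inr (by exact_mod_cast hc0))
  have hcont : ContinuousAt (fderiv ℝ U) p := hU.continuousAt_fderiv one_ne_zero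
  have hev : ∀ᶠ x in nhds p, |‖fderiv ℝ U x‖ - g| ≤ θ * g := by
    have := (hcont.norm).tendsto.eventually (Metric.closedBall_mem_nhds g hc0)
    simpa [Real.dist_eq] using this
  have hgrad : ∀ v, fderiv ℝ U p v = inner ℝ (gradient U p) v := fun v => by
    simp [gradient]
  have hgn : ‖gradient U p‖ = g := by simp [gradient, hg]
  obtain ⟨N, hN, hNo, hpN⟩ := mem_nhds_iff.1
    (Filter.inter_mem (Filter.inter_mem hs hev) (Filter.inter_mem hW (Metric.ball_mem_nhds p one_pos)))
  refine ⟨N, g⁻¹ • gradient U p, hNo, hpN, fun x hx => (hN hx).2.1,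
    Metric.isBounded_ball.subset fun x hx => (hN hx).2.2,
    ?_, hsl.continuousOn.mono fun x hx => (hN hx).1.1,
    ⟨hg0, hc0.le, by nlinarith, fun x hx y hy => ?_⟩, fun x hx => (hN hx).1.2⟩
  · rw [norm_smul, hgn, norm_inv, Real.norm_of_nonneg hg0.le, inv_mul_cancel₀ hg0.ne']
  · have := hsl x (hN hx).1.1 y (hN hy).1.1
    rw [real_inner_smul_left, ← mul_assoc, mul_inv_cancel₀ hg0.ne', one_mul, ← hgrad]
    rw [Real.norm_eq_abs] at this
    exact this

/-- Local form of the upper coarea bound near a regular point. -/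
theorem exists_nhds_integral_slab_le {k : ℕ} {U : Eucl (k + 1) → ℝ} {p : Eucl (k + 1)}
    (hU : ContDiffAt ℝ 1 U p) (hp : fderiv ℝ U p ≠ 0) {W : Set (Eucl (k + 1))}
    (hW : W ∈ nhds p) {δ : ℝ} (hδ : 0 < δ) (ρ : ℝ) :
    ∃ N, IsOpen N ∧ p ∈ N ∧ N ⊆ W ∧ μH[(k : ℝ)] (N ∩ {x | U x = ρ}) < ⊤ ∧
      ∀ f : Eucl (k + 1) → ℝ, Continuous f → (∀ x, 0 ≤ f x) → HasCompactSupport f →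
        tsupport f ⊆ N → ∀ η > 0, ∀ᶠ ε in nhdsWithin 0 (Set.Ioi 0),
          ∫ x in {x ∈ N | ρ ≤ U x ∧ U x < ρ + ε}, f x ≤
            ε * ((1 + δ) * ∫ x in N ∩ {x | U x = ρ}, f x / ‖fderiv ℝ U x‖ ∂μH[(k : ℝ)] + η) := by
  obtain ⟨θ, hθ, hθ', hθδ⟩ : ∃ θ : ℝ, 0 < θ ∧ θ ≤ 1 / 2 ∧ θ * (2 + δ) ≤ δ := by
    refine ⟨δ / (2 + 2 * δ), by positivity, ?_, ?_⟩
    · rw [div_le_div_iff₀ (by positivity) (by positivity)]; linarith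
    · rw [div_mul_eq_mul_div, div_le_iff₀ (by positivity)]; nlinarith
  obtain ⟨N, e, hNo, hpN, hNW, hNb, he, hUc, hN, hfd⟩ := exists_nearlyLinearOn hU hp hW hθ hθ'
  obtain ⟨C⟩ := AxisCoords.nonempty e he
  set g := ‖fderiv ℝ U p‖ with hg
  set c := θ * g with hc
  have hg0 : 0 < g := hN.slope_pos
  have hgc : 0 < g - c := by nlinarith
  have hfin := hN.hausdorffMeasure_lt_top C hNb ρ
  refine ⟨N, hNo, hpN, hNW, hfin, fun f hf hf0 hfc hfN η hη => ?_⟩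
  set S := N ∩ {x | U x = ρ} with hS
  have hSm : MeasurableSet S :=
    hUc.measurableSet_inter_preimage hNo.measurableSet (measurableSet_singleton ρ)
  set K := tsupport f with hK
  have hKc : IsCompact K := hfc
  have hvolK : volume (C.proj '' K) ≠ ⊤ :=
    (hKc.image C.lipschitz_proj.continuous).measure_lt_top.ne
  set v := (volume (C.proj '' K)).toReal with hv
  have hv0 : 0 ≤ v := ENNReal.toReal_nonneg
  set ω := η * (g - c) / (v + 1) with hω
  have hω0 : 0 < ω := by positivity
  obtain ⟨d₁, hd₁, hd₁f⟩ := Metric.uniformContinuous_iff.1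
    (hfc.uniformContinuous_of_continuous hf) ω hω0
  obtain ⟨d₂, hd₂, hd₂N⟩ := hKc.exists_cthickening_subset_open hNo hfN
  set d := min (d₁ / 2) d₂ with hd
  have hd0 : 0 < d := by positivity
  have hsmall : ∀ᶠ ε in nhdsWithin (0 : ℝ) (Set.Ioi 0), ε ≤ d * (g - c) :=
    nhdsWithin_le_nhds (eventually_le_nhds (by positivity))
  filter_upwards [hsmall, self_mem_nhdsWithin] with ε hεd hε
  have hε : 0 < ε := hε
  have hmain := hN.lintegral_slab_le he hNo hUc C hf hKc (fun x hx => image_eq_zero_of_notMem_tsupport hx)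
    (d := d) (ω := ω) (fun x hx => (Metric.closedBall_subset_closedBall (min_le_right _ _)).trans
      ((Metric.closedBall_subset_cthickening hx d₂).trans hd₂N))
    (fun x y hxy => by
      have := hd₁f (a := x) (b := y) (by linarith [min_le_left (d₁ / 2) d₂])
      rw [Real.dist_eq] at this
      linarith [le_abs_self (f x - f y)])
    (ρ := ρ) hε (by rwa [div_le_iff₀ hgc])
  have : IsFiniteMeasure (μH[(k : ℝ)].restrict S) := ⟨by simpa using hfin⟩
  obtain ⟨B, hB⟩ := hfc.exists_bound_of_continuous hf
  have hint : IntegrableOn f S μH[(k : ℝ)] :=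
    Integrable.of_bound hf.aestronglyMeasurable B (Filter.Eventually.of_forall hB)
  have hint' : IntegrableOn (fun x => f x / ‖fderiv ℝ U x‖) S μH[(k : ℝ)] := by
    refine Integrable.of_bound (hf.measurable.div
      (measurable_fderiv ℝ U).norm).aestronglyMeasurable (B / (g - c)) ?_
    refine (ae_restrict_iff' hSm).2 (Filter.Eventually.of_forall fun x hx => ?_)
    rw [norm_div, norm_norm]
    have := (abs_le.1 (hfd x hx.1)).1
    exact div_le_div₀ ((norm_nonneg _).trans (hB x)) (hB x) hgc (by linarith)
  have hcmp : ∫ x in S, f x ∂μH[(k : ℝ)] ≤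
      (g + c) * ∫ x in S, f x / ‖fderiv ℝ U x‖ ∂μH[(k : ℝ)] := by
    rw [← integral_const_mul]
    refine setIntegral_mono_on hint (hint'.const_mul _) hSm fun x hx => ?_
    have := abs_le.1 (hfd x hx.1)
    have hpos : 0 < ‖fderiv ℝ U x‖ := by linarith
    rw [mul_div_assoc', le_div_iff₀ hpos, mul_comm]
    exact mul_le_mul_of_nonneg_right (by linarith) (hf0 x)
  have hI0 : 0 ≤ ∫ x in S, f x / ‖fderiv ℝ U x‖ ∂μH[(k : ℝ)] :=
    integral_nonneg fun x => div_nonneg (hf0 x) (norm_nonneg _)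
  set I := ∫ x in S, f x / ‖fderiv ℝ U x‖ ∂μH[(k : ℝ)] with hI
  have hfirst : ∫ x in {x ∈ N | ρ ≤ U x ∧ U x < ρ + ε}, f x ≤
      ε / (g - c) * (∫ x in S, f x ∂μH[(k : ℝ)] + ω * v) := by
    rw [integral_eq_lintegral_of_nonneg_ae (Filter.Eventually.of_forall hf0)
      hf.aestronglyMeasurable]
    refine ENNReal.toReal_le_of_le_ofReal ?_ (hmain.trans_eq ?_)
    · have : 0 ≤ ∫ x in S, f x ∂μH[(k : ℝ)] := integral_nonneg hf0
      positivity
    · rw [ENNReal.ofReal_mul (by positivity), ENNReal.ofReal_add (integral_nonneg hf0)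
        (by positivity), ENNReal.ofReal_mul hω0.le, hv, ENNReal.ofReal_toReal hvolK,
        ofReal_integral_eq_lintegral_ofReal hint (Filter.Eventually.of_forall hf0)]
  refine hfirst.trans ?_
  rw [div_mul_eq_mul_div, mul_div_assoc]
  refine mul_le_mul_of_nonneg_left ?_ hε.le
  rw [div_le_iff₀ hgc]
  have h1 : ω * v ≤ η * (g - c) := by
    rw [hω, div_mul_eq_mul_div, div_le_iff₀ (by positivity)]
    have : 0 ≤ η * (g - c) := by positivity
    nlinarith
  have h2 : (g + c) * I ≤ (1 + δ) * I * (g - c) := by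
    have : g + c ≤ (1 + δ) * (g - c) := by rw [hc]; nlinarith
    nlinarith
  linarith

theorem ContinuousOn.continuous_mul_of_tsupport_subset {X : Type*} [TopologicalSpace X]
    {f χ : X → ℝ} {W : Set X} (hf : ContinuousOn f W) (hW : IsOpen W) (hχ : Continuous χ)
    (h : tsupport χ ⊆ W) : Continuous fun x => χ x * f x := by
  refine continuous_of_tsupport fun x hx => ?_
  exact hχ.continuousAt.mul (hf.continuousAt (hW.mem_nhds (h (tsupport_mul_subset_left hx))))

theorem integrableOn_div_norm_fderiv_levelSet {n : ℕ} {U f : Eucl n → ℝ} {W : Set (Eucl n)}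
    (hW : IsOpen W) (hU : ContDiffOn ℝ 1 U W) {ρ ρ₁ : ℝ} (hρ : ρ ≤ ρ₁)
    (hK : IsCompact {x ∈ W | ρ ≤ U x ∧ U x ≤ ρ₁})
    (hreg : ∀ x ∈ W, ρ ≤ U x → U x ≤ ρ₁ → fderiv ℝ U x ≠ 0) (hf : ContinuousOn f W)
    {d : ℝ} (hfin : μH[d] {x ∈ W | U x = ρ} < ⊤) :
    IntegrableOn (fun x => f x / ‖fderiv ℝ U x‖) {x ∈ W | U x = ρ} μH[d] := by
  have hSm : MeasurableSet {x ∈ W | U x = ρ} :=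
    hU.continuousOn.measurableSet_inter_preimage hW.measurableSet (measurableSet_singleton ρ)
  have hSK : {x ∈ W | U x = ρ} ⊆ {x ∈ W | ρ ≤ U x ∧ U x ≤ ρ₁} :=
    fun x hx => ⟨hx.1, hx.2.ge, hx.2.le.trans hρ⟩
  have hcont : ContinuousOn (fun x => f x / ‖fderiv ℝ U x‖) {x ∈ W | ρ ≤ U x ∧ U x ≤ ρ₁} :=
    (hf.mono fun x hx => hx.1).div
      ((hU.continuousOn_fderiv_of_isOpen hW le_rfl).norm.mono fun x hx => hx.1)
      fun x hx => norm_ne_zero_iff.2 (hreg x hx.1 hx.2.1 hx.2.2)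
  obtain ⟨B, hB⟩ := hK.exists_bound_of_continuousOn hcont
  have : IsFiniteMeasure (μH[d].restrict {x ∈ W | U x = ρ}) := ⟨by simpa using hfin⟩
  exact Integrable.of_bound ((hcont.mono hSK).aestronglyMeasurable hSm) B
    ((ae_restrict_iff' hSm).2 (Filter.Eventually.of_forall fun x hx => hB x (hSK hx)))

/-- Finite partition of unity used to globalize local slab estimates. -/
theorem IsCompact.exists_finite_partition {X : Type*} [TopologicalSpace X] [T2Space X]
    [LocallyCompactSpace X] {K : Set X} (hK : IsCompact K) {N : X → Set X}
    (hNo : ∀ p ∈ K, IsOpen (N p)) (hpN : ∀ p ∈ K, p ∈ N p) :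
    ∃ (t : Finset X) (χ : X → X → ℝ), ↑t ⊆ K ∧ K ⊆ ⋃ p ∈ t, N p ∧ (∀ p ∈ t, Continuous (χ p)) ∧
      (∀ p ∈ t, ∀ x, 0 ≤ χ p x) ∧ (∀ p ∈ t, HasCompactSupport (χ p)) ∧
      (∀ p ∈ t, tsupport (χ p) ⊆ N p) ∧ ∀ x ∈ K, ∑ p ∈ t, χ p x = 1 := by
  obtain ⟨t, htK, ht⟩ := hK.elim_nhds_subcover N fun p hp => (hNo p hp).mem_nhds (hpN p hp)
  obtain ⟨F, hF, hFc⟩ := PartitionOfUnity.exists_isSubordinate_of_locallyFinite_t2space hK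
    (fun p : t => N p) (fun p => hNo p (htK p p.2)) (locallyFinite_of_finite _)
    (fun x hx => by simpa using ht hx)
  classical
  refine ⟨t, fun p => if h : p ∈ t then F ⟨p, h⟩ else 0, htK, ht, ?_, ?_, ?_, ?_, ?_⟩
  · intro p hp
    simp only [hp, dif_pos]
    exact (F ⟨p, hp⟩).continuous
  · intro p hp x
    simp only [hp, dif_pos]
    exact F.nonneg _ x
  · intro p hp
    simp only [hp, dif_pos]
    exact hFc ⟨p, hp⟩
  · intro p hp
    simp only [hp, dif_pos]
    exact hF ⟨p, hp⟩
  · intro x hx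
    have := F.sum_eq_one hx
    rw [finsum_eq_sum_of_fintype] at this
    rw [← this, ← Finset.sum_coe_sort]
    refine Finset.sum_congr rfl fun p _ => ?_
    simp

/-- Upper coarea bound: the mass of thin slabs above a regular level set is asymptotically
bounded by the surface integral over that level set. -/
theorem eventually_integral_slab_le {k : ℕ} {U f : Eucl (k + 1) → ℝ} {W : Set (Eucl (k + 1))}
    (hW : IsOpen W) (hU : ContDiffOn ℝ 1 U W) {ρ ρ₁ : ℝ} (hρ : ρ < ρ₁)
    (hK : IsCompact {x ∈ W | ρ ≤ U x ∧ U x ≤ ρ₁})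
    (hreg : ∀ x ∈ W, ρ ≤ U x → U x ≤ ρ₁ → fderiv ℝ U x ≠ 0) (hf : ContinuousOn f W)
    (hf0 : ∀ x ∈ W, 0 ≤ f x) :
    μH[(k : ℝ)] {x ∈ W | U x = ρ} < ⊤ ∧
      ∀ θ > 0, ∀ᶠ ε in nhdsWithin 0 (Set.Ioi 0),
        ∫ x in {x ∈ W | ρ ≤ U x ∧ U x < ρ + ε}, f x ≤
          ε * (∫ x in {x ∈ W | U x = ρ}, f x / ‖fderiv ℝ U x‖ ∂μH[(k : ℝ)] + θ) := by
  set K := {x ∈ W | ρ ≤ U x ∧ U x ≤ ρ₁} with hKdef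
  set S := {x ∈ W | U x = ρ} with hS
  have hSm : MeasurableSet S :=
    hU.continuousOn.measurableSet_inter_preimage hW.measurableSet (measurableSet_singleton ρ)
  have hSK : S ⊆ K := fun x hx => ⟨hx.1, hx.2.ge, hx.2.le.trans hρ.le⟩
  have hloc := fun (δ : ℝ) (hδ : 0 < δ) (p : Eucl (k + 1)) (hp : p ∈ K) =>
    exists_nhds_integral_slab_le (hU.contDiffAt (hW.mem_nhds hp.1))
      (hreg p hp.1 hp.2.1 hp.2.2) (hW.mem_nhds hp.1) hδ ρ
  have hfin : μH[(k : ℝ)] S < ⊤ := by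
    choose! N hNo hpN hNW hNfin _ using hloc 1 one_pos
    obtain ⟨t, htK, ht⟩ := hK.elim_nhds_subcover N fun p hp => (hNo p hp).mem_nhds (hpN p hp)
    refine (measure_mono (t := ⋃ p ∈ t, N p ∩ {x | U x = ρ}) fun x hx => ?_).trans_lt
      (measure_biUnion_lt_top t.finite_toSet fun p hp => hNfin p (htK p hp))
    obtain ⟨p, hp, hxp⟩ := Set.mem_iUnion₂.1 (ht (hSK hx))
    exact Set.mem_iUnion₂.2 ⟨p, hp, hxp, hx.2⟩
  refine ⟨hfin, fun θ hθ => ?_⟩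
  have hint := integrableOn_div_norm_fderiv_levelSet hW hU hρ.le hK hreg hf hfin
  set I := ∫ x in S, f x / ‖fderiv ℝ U x‖ ∂μH[(k : ℝ)] with hI
  have hI0 : 0 ≤ I := setIntegral_nonneg hSm fun x hx => div_nonneg (hf0 x hx.1) (norm_nonneg _)
  choose! N hNo hpN hNW _ hNs using hloc (θ / (2 * (I + 1))) (by positivity)
  obtain ⟨t, χ, htK, -, hχc, hχ0, hχs, hχN, hχ1⟩ := hK.exists_finite_partition hNo hpN
  have hcont : ∀ p ∈ t, Continuous fun x => χ p x * f x := fun p hp =>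
    hf.continuous_mul_of_tsupport_subset hW (hχc p hp) ((hχN p hp).trans (hNW p (htK hp)))
  have hsupp : ∀ p ∈ t, HasCompactSupport fun x => χ p x * f x := fun p hp => (hχs p hp).mul_right
  have hzero : ∀ p ∈ t, ∀ x, x ∉ N p → χ p x = 0 := fun p hp x hx =>
    image_eq_zero_of_notMem_tsupport fun h => hx (hχN p hp h)
  have hnonneg : ∀ p ∈ t, ∀ x, 0 ≤ χ p x * f x := by
    intro p hp x
    by_cases hx : x ∈ N p
    · exact mul_nonneg (hχ0 p hp x) (hf0 x (hNW p (htK hp) hx))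
    · simp [hzero p hp x hx]
  have hev : ∀ᶠ ε in nhdsWithin (0 : ℝ) (Set.Ioi 0), ∀ p ∈ t,
      ∫ x in {x ∈ N p | ρ ≤ U x ∧ U x < ρ + ε}, χ p x * f x ≤
        ε * ((1 + θ / (2 * (I + 1))) *
          ∫ x in N p ∩ {x | U x = ρ}, χ p x * f x / ‖fderiv ℝ U x‖ ∂μH[(k : ℝ)]
          + θ / (2 * (t.card + 1))) :=
    (Filter.eventually_all_finset t).2 fun p hp =>
      hNs p (htK hp) _ (hcont p hp) (hnonneg p hp) (hsupp p hp)
        ((tsupport_mul_subset_left).trans (hχN p hp)) _ (by positivity)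
  have hsmall : ∀ᶠ ε in nhdsWithin (0 : ℝ) (Set.Ioi 0), ε ≤ ρ₁ - ρ :=
    nhdsWithin_le_nhds (eventually_le_nhds (by linarith))
  filter_upwards [hev, hsmall, self_mem_nhdsWithin] with ε hεs hερ hε
  have hε : 0 < ε := hε
  set T := {x ∈ W | ρ ≤ U x ∧ U x < ρ + ε} with hT
  have hTm : MeasurableSet T := hU.continuousOn.measurableSet_inter_preimage hW.measurableSet
    (measurableSet_Ico (a := ρ) (b := ρ + ε))
  have hTK : T ⊆ K := fun x hx => ⟨hx.1, hx.2.1, by linarith [hx.2.2]⟩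
  have hleft : ∫ x in T, f x = ∑ p ∈ t, ∫ x in {x ∈ N p | ρ ≤ U x ∧ U x < ρ + ε}, χ p x * f x := by
    calc ∫ x in T, f x = ∫ x in T, ∑ p ∈ t, χ p x * f x :=
          setIntegral_congr_fun hTm fun x hx => by
            simp only [← Finset.sum_mul, hχ1 x (hTK hx), one_mul]
      _ = ∑ p ∈ t, ∫ x in T, χ p x * f x := integral_finsetSum _ fun p hp =>
          ((hcont p hp).integrable_of_hasCompactSupport (hsupp p hp)).integrableOn
      _ = _ := Finset.sum_congr rfl fun p hp =>
          (setIntegral_eq_of_subset_of_forall_sdiff_eq_zero hTm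
            (fun x hx => ⟨hNW p (htK hp) hx.1, hx.2⟩) fun x hx => by
              rw [hzero p hp x fun h => hx.2 ⟨h, hx.1.2⟩, zero_mul])
  have hright : ∑ p ∈ t, ∫ x in N p ∩ {x | U x = ρ}, χ p x * f x / ‖fderiv ℝ U x‖ ∂μH[(k : ℝ)]
      = I := by
    calc _ = ∑ p ∈ t, ∫ x in S, χ p x * f x / ‖fderiv ℝ U x‖ ∂μH[(k : ℝ)] :=
          Finset.sum_congr rfl fun p hp =>
          (setIntegral_eq_of_subset_of_forall_sdiff_eq_zero hSm
            (fun x hx => ⟨hNW p (htK hp) hx.1, hx.2⟩) fun x hx => by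
              rw [hzero p hp x fun h => hx.2 ⟨h, hx.1.2⟩, zero_mul, zero_div]).symm
      _ = ∫ x in S, ∑ p ∈ t, χ p x * f x / ‖fderiv ℝ U x‖ ∂μH[(k : ℝ)] :=
          (integral_finsetSum _ fun p hp => by
            simp only [mul_div_assoc]
            obtain ⟨B, hB⟩ := (hχs p hp).exists_bound_of_continuous (hχc p hp)
            exact hint.bdd_mul (hχc p hp).aestronglyMeasurable
              (Filter.Eventually.of_forall hB)).symm
      _ = I := setIntegral_congr_fun hSm fun x hx => by
            simp only [← Finset.sum_mul, ← Finset.sum_div, hχ1 x (hSK hx), one_mul]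
  rw [hleft]
  refine (Finset.sum_le_sum hεs).trans ?_
  rw [← Finset.mul_sum, Finset.sum_add_distrib, ← Finset.mul_sum, hright, Finset.sum_const,
    nsmul_eq_mul]
  refine mul_le_mul_of_nonneg_left ?_ hε.le
  have h1 : θ / (2 * (I + 1)) * I ≤ θ / 2 := by
    rw [div_mul_eq_mul_div, div_le_div_iff₀ (by positivity) two_pos]
    nlinarith
  have h2 : (t.card : ℝ) * (θ / (2 * (t.card + 1))) ≤ θ / 2 := by
    rw [mul_div_assoc', div_le_div_iff₀ (by positivity) two_pos]
    nlinarith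
  linarith

theorem contDiff_pd {n : ℕ} {f : Eucl n → ℝ} {m m' : WithTop ℕ∞} (hf : ContDiff ℝ m f)
    (hm : m' + 1 ≤ m) (i : Fin n) : ContDiff ℝ m' (pd f i) :=
  (hf.fderiv_right hm).clm_apply contDiff_const

theorem HasCompactSupport.pd {n : ℕ} {f : Eucl n → ℝ} (hf : HasCompactSupport f) (i : Fin n) :
    HasCompactSupport (pd f i) :=
  hf.fderiv_apply ℝ _

theorem pd_normed_convolution {n : ℕ} (φ : ContDiffBump (0 : Eucl n)) {f : Eucl n → ℝ}
    (hf : ContDiff ℝ 1 f) (hc : HasCompactSupport f) (i : Fin n) :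
    pd (convolution (φ.normed volume) f (ContinuousLinearMap.lsmul ℝ ℝ) volume) i =
      convolution (φ.normed volume) (pd f i) (ContinuousLinearMap.lsmul ℝ ℝ) volume := by
  funext x
  have hloc : LocallyIntegrable (φ.normed (volume : Measure (Eucl n))) volume :=
    φ.continuous_normed.locallyIntegrable
  rw [pd, (hc.hasFDerivAt_convolution_right (ContinuousLinearMap.lsmul ℝ ℝ) hloc hf x).fderiv,
    convolution_precompR_apply _ hloc (hc.fderiv ℝ) (hf.continuous_fderiv one_ne_zero)]
  rfl

theorem exists_smooth_approx {n : ℕ} {f : Eucl n → ℝ} (hf : ContDiff ℝ 2 f)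
    (hc : HasCompactSupport f) {r : ℝ} (hr : 0 < r) {η : ℝ} (hη : 0 < η) :
    ∃ F : Eucl n → ℝ, ContDiff ℝ (⊤ : ℕ∞) F ∧ tsupport F ⊆ Metric.cthickening r (tsupport f) ∧
      (∀ i x, |pd F i x - pd f i x| ≤ η) ∧ ∀ i j x, |pd2 F i j x - pd2 f i j x| ≤ η := by
  have h1 : ∀ j, ContDiff ℝ 1 (pd f j) := fun j => contDiff_pd hf le_rfl j
  have hc1 : ∀ j, HasCompactSupport (pd f j) := fun j => hc.pd j
  have h2 : ∀ i j, Continuous (pd (pd f j) i) := fun i j =>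
    (contDiff_pd (m' := 0) (h1 j) (by simp) i).continuous
  have huc : ∀ F : Eucl n → ℝ, Continuous F → HasCompactSupport F →
      ∀ᶠ δ in nhdsWithin (0 : ℝ) (Set.Ioi 0), ∀ x y, dist x y < δ → dist (F x) (F y) ≤ η := by
    intro F hF hFc
    obtain ⟨δ, hδ, h⟩ := Metric.uniformContinuous_iff.1
      (hFc.uniformContinuous_of_continuous hF) η hη
    filter_upwards [nhdsWithin_le_nhds (eventually_le_nhds hδ)] with δ' hδ' x y hxy
    exact (h (hxy.trans_le hδ')).le
  have hev1 := Filter.eventually_all.2 fun i => huc _ (h1 i).continuous (hc1 i)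
  have hev2 := Filter.eventually_all.2 fun i => Filter.eventually_all.2 fun j =>
    huc _ (h2 i j) ((hc1 j).pd i)
  have hev3 : ∀ᶠ δ in nhdsWithin (0 : ℝ) (Set.Ioi 0), δ ≤ r :=
    nhdsWithin_le_nhds (eventually_le_nhds hr)
  obtain ⟨δ, hδ1, hδ2, hδr, hδ⟩ :=
    (hev1.and (hev2.and (hev3.and self_mem_nhdsWithin))).exists
  have hδ : 0 < δ := hδ
  let φ : ContDiffBump (0 : Eucl n) := ⟨δ / 2, δ, by positivity, by linarith⟩
  have hpd : ∀ i, pd (convolution (φ.normed volume) f (ContinuousLinearMap.lsmul ℝ ℝ) volume) i =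
      convolution (φ.normed volume) (pd f i) (ContinuousLinearMap.lsmul ℝ ℝ) volume := fun i =>
    pd_normed_convolution φ (hf.of_le one_le_two) hc i
  refine ⟨convolution (φ.normed volume) f (ContinuousLinearMap.lsmul ℝ ℝ) volume, ?_, ?_, ?_, ?_⟩
  · exact φ.hasCompactSupport_normed.contDiff_convolution_left _ φ.contDiff_normed
      hf.continuous.locallyIntegrable
  · refine closure_minimal ?_ Metric.isClosed_cthickening
    refine (support_convolution_subset _).trans ?_
    rw [φ.support_normed_eq]
    rintro _ ⟨x, hx, y, hy, rfl⟩
    refine Metric.mem_cthickening_of_dist_le _ y _ _ (subset_tsupport f hy) ?_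
    have : ‖x‖ < δ := by simpa using hx
    simpa [dist_eq_norm] using this.le.trans hδr
  · intro i x
    rw [hpd, ← Real.dist_eq]
    exact φ.dist_normed_convolution_le (h1 i).continuous.aestronglyMeasurable
      fun y hy => hδ1 i y x hy
  · intro i j x
    change |pd (pd _ j) i x - pd (pd f j) i x| ≤ η
    rw [hpd, pd_normed_convolution φ (h1 j) (hc1 j), ← Real.dist_eq]
    exact φ.dist_normed_convolution_le (h2 i j).aestronglyMeasurable
      fun y hy => hδ2 i j y x hy

theorem abs_Lop_sub_le {n : ℕ} (a : Eucl n → Matrix (Fin n) (Fin n) ℝ) (V : Eucl n → Fin n → ℝ)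
    {f F : Eucl n → ℝ} {η : ℝ} {x : Eucl n} (h1 : ∀ i, |pd F i x - pd f i x| ≤ η)
    (h2 : ∀ i j, |pd2 F i j x - pd2 f i j x| ≤ η) :
    |Lop a V F x - Lop a V f x| ≤ η * ((∑ i, ∑ j, |a x i j|) + ∑ i, |V x i|) := by
  have : Lop a V F x - Lop a V f x = (∑ i, ∑ j, a x i j * (pd2 F i j x - pd2 f i j x)) +
      ∑ i, V x i * (pd F i x - pd f i x) := by
    simp only [Lop, mul_sub, Finset.sum_sub_distrib]
    ring
  rw [this, mul_add, Finset.mul_sum, Finset.mul_sum]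
  refine (abs_add_le _ _).trans (add_le_add ?_ ?_)
  · refine (Finset.abs_sum_le_sum_abs _ _).trans (Finset.sum_le_sum fun i _ => ?_)
    rw [Finset.mul_sum]
    refine (Finset.abs_sum_le_sum_abs _ _).trans (Finset.sum_le_sum fun j _ => ?_)
    rw [abs_mul, mul_comm]
    exact mul_le_mul_of_nonneg_right (h2 i j) (abs_nonneg _)
  · refine (Finset.abs_sum_le_sum_abs _ _).trans (Finset.sum_le_sum fun i _ => ?_)
    rw [abs_mul, mul_comm]
    exact mul_le_mul_of_nonneg_right (h1 i) (abs_nonneg _)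

theorem pd_eq_zero_of_notMem_tsupport {n : ℕ} {f : Eucl n → ℝ} {x : Eucl n} (hx : x ∉ tsupport f)
    (i : Fin n) : pd f i x = 0 := by
  rw [pd, image_eq_zero_of_notMem_tsupport fun h => hx (tsupport_fderiv_subset ℝ h)]
  rfl

theorem pd2_eq_zero_of_notMem_tsupport {n : ℕ} {f : Eucl n → ℝ} {x : Eucl n} (hx : x ∉ tsupport f)
    (i j : Fin n) : pd2 f i j x = 0 := by
  refine pd_eq_zero_of_notMem_tsupport (f := pd f j) (fun h => hx ?_) i
  exact tsupport_fderiv_apply_subset ℝ _ h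

theorem Lop_eq_zero_of_notMem_tsupport {n : ℕ} (a : Eucl n → Matrix (Fin n) (Fin n) ℝ)
    (V : Eucl n → Fin n → ℝ) {f : Eucl n → ℝ} {x : Eucl n} (hx : x ∉ tsupport f) :
    Lop a V f x = 0 := by
  simp [Lop, pd_eq_zero_of_notMem_tsupport hx, pd2_eq_zero_of_notMem_tsupport hx]

theorem ContinuousOn.integrableOn_of_eq_zero {n : ℕ} {G : Eucl n → ℝ} {W K : Set (Eucl n)}
    (hW : MeasurableSet W) (hG : ContinuousOn G W) (hK : IsCompact K) (hKW : K ⊆ W)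
    (h0 : ∀ x ∈ W, x ∉ K → G x = 0) : IntegrableOn G W :=
  ((hG.mono hKW).integrableOn_compact hK).of_forall_sdiff_eq_zero hW fun x hx => h0 x hx.1 hx.2

theorem continuousOn_Lop {n : ℕ} {a : Eucl n → Matrix (Fin n) (Fin n) ℝ} {V : Eucl n → Fin n → ℝ}
    {f : Eucl n → ℝ} {W : Set (Eucl n)} (hW : IsOpen W)
    (ha : ∀ i j, ContinuousOn (fun x => a x i j) W) (hV : ContinuousOn V W)
    (hf : ContDiffOn ℝ 2 f W) : ContinuousOn (Lop a V f) W := by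
  have h1 : ∀ j, ContDiffOn ℝ 1 (pd f j) W := fun j =>
    (hf.fderiv_of_isOpen hW le_rfl).clm_apply contDiffOn_const
  have h2 : ∀ i j, ContinuousOn (pd2 f i j) W := fun i j =>
    ((h1 j).continuousOn_fderiv_of_isOpen hW le_rfl).clm_apply continuousOn_const
  refine ContinuousOn.add ?_ ?_
  · exact continuousOn_finsetSum _ fun i _ => continuousOn_finsetSum _ fun j _ =>
      (ha i j).mul (h2 i j)
  · exact continuousOn_finsetSum _ fun i _ =>
      (continuousOn_pi.1 hV i).mul (h1 i).continuousOn

/-- The stationarity identity extends from smooth to `C²` test functions. -/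
theorem integral_Lop_mul_eq_zero {n : ℕ} {W : Set (Eucl n)} (hW : IsOpen W)
    {a : Eucl n → Matrix (Fin n) (Fin n) ℝ} (ha : ∀ i j, ContinuousOn (fun x => a x i j) W)
    {V : Eucl n → Fin n → ℝ} (hV : ContinuousOn V W) {u : Eucl n → ℝ} (hu : ContinuousOn u W)
    (hstat : ∀ f : Eucl n → ℝ, ContDiff ℝ (⊤ : ℕ∞) f → HasCompactSupport f →
      tsupport f ⊆ W → (∫ x in W, Lop a V f x * u x) = 0)
    {f : Eucl n → ℝ} (hf : ContDiff ℝ 2 f) (hc : HasCompactSupport f) (hfW : tsupport f ⊆ W) :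
    ∫ x in W, Lop a V f x * u x = 0 := by
  obtain ⟨r, hr, hrW⟩ := hc.isCompact.exists_cthickening_subset_open hW hfW
  set K := Metric.cthickening r (tsupport f) with hKdef
  have hK : IsCompact K := hc.isCompact.cthickening
  set B : Eucl n → ℝ := fun x => ((∑ i, ∑ j, |a x i j|) + ∑ i, |V x i|) * |u x| with hB
  have hBc : ContinuousOn B K := by
    refine ContinuousOn.mono ?_ hrW
    refine ContinuousOn.mul (ContinuousOn.add ?_ ?_) hu.abs
    · exact continuousOn_finsetSum _ fun i _ => continuousOn_finsetSum _ fun j _ => (ha i j).abs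
    · exact continuousOn_finsetSum _ fun i _ => (continuousOn_pi.1 hV i).abs
  have hBi : IntegrableOn B K := hBc.integrableOn_compact hK
  set M := ∫ x in K, B x with hM
  have hM0 : 0 ≤ M := integral_nonneg fun x => by positivity
  have hint : ∀ F : Eucl n → ℝ, ContDiff ℝ 2 F → tsupport F ⊆ K →
      IntegrableOn (fun x => Lop a V F x * u x) W := fun F hF hFK =>
    ContinuousOn.integrableOn_of_eq_zero hW.measurableSet
      ((continuousOn_Lop hW ha hV hF.contDiffOn).mul hu) hK hrW fun x _ hx => by
        rw [Lop_eq_zero_of_notMem_tsupport a V fun h => hx (hFK h), zero_mul]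
  have key : ∀ η > 0, |∫ x in W, Lop a V f x * u x| ≤ η * M := by
    intro η hη
    obtain ⟨F, hF, hFK, hF1, hF2⟩ := exists_smooth_approx hf hc hr hη
    have hFc : HasCompactSupport F := hK.of_isClosed_subset (isClosed_tsupport F) hFK
    have hfK : tsupport f ⊆ K := Metric.self_subset_cthickening _
    have h0 := hstat F hF hFc (hFK.trans hrW)
    have hF2' : ContDiff ℝ 2 F := contDiff_infty.1 hF 2
    rw [← abs_neg, ← zero_sub, ← h0, ← integral_sub (hint F hF2' hFK) (hint f hf hfK),
      setIntegral_eq_of_subset_of_forall_sdiff_eq_zero hW.measurableSet hrW (fun x hx => by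
        rw [Lop_eq_zero_of_notMem_tsupport a V fun h => hx.2 (hFK h),
          Lop_eq_zero_of_notMem_tsupport a V fun h => hx.2 (hfK h), sub_self]),
      ← integral_const_mul, ← Real.norm_eq_abs]
    refine norm_integral_le_of_norm_le (hBi.const_mul η) (Filter.Eventually.of_forall fun x => ?_)
    rw [← sub_mul, norm_mul, Real.norm_eq_abs, Real.norm_eq_abs, hB]
    simp only [← mul_assoc]
    exact mul_le_mul_of_nonneg_right
      (abs_Lop_sub_le a V (fun i => hF1 i x) fun i j => hF2 i j x) (abs_nonneg _)
  refine abs_nonpos_iff.1 (le_of_forall_pos_le_add fun θ hθ => ?_)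
  refine (key (θ / (M + 1)) (by positivity)).trans ?_
  rw [zero_add, div_mul_eq_mul_div, div_le_iff₀ (by positivity)]
  nlinarith

theorem contDiff_two_of_hasDerivAt {φ ψ q : ℝ → ℝ} (hφ : ∀ t, HasDerivAt φ (ψ t) t)
    (hψ : ∀ t, HasDerivAt ψ (q t) t) (hq : Continuous q) : ContDiff ℝ 2 φ := by
  have hdψ : deriv ψ = q := funext fun t => (hψ t).deriv
  have hdφ : deriv φ = ψ := funext fun t => (hφ t).deriv
  have h1 : ContDiff ℝ 1 ψ :=
    contDiff_one_iff_deriv.2 ⟨fun t => (hψ t).differentiableAt, by rwa [hdψ]⟩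
  rw [show (2 : WithTop ℕ∞) = 1 + 1 from one_add_one_eq_two.symm, contDiff_succ_iff_deriv, hdφ]
  exact ⟨fun t => (hφ t).differentiableAt, by simp, h1⟩

theorem Filter.EventuallyEq.pd_eq {n : ℕ} {f g : Eucl n → ℝ} {x : Eucl n} (h : f =ᶠ[nhds x] g)
    (i : Fin n) : pd f i x = pd g i x := by
  rw [pd, h.fderiv_eq, pd]

theorem pd_comp {n : ℕ} {φ : ℝ → ℝ} {c : ℝ} {U : Eucl n → ℝ} {x : Eucl n}
    (hφ : HasDerivAt φ c (U x)) (hU : DifferentiableAt ℝ U x) (i : Fin n) :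
    pd (fun y => φ (U y)) i x = c * pd U i x := by
  have := (hφ.comp_hasFDerivAt x hU.hasFDerivAt).fderiv
  rw [pd, show (fun y => φ (U y)) = φ ∘ U from rfl, this]
  rfl

theorem Lop_comp {n : ℕ} (a : Eucl n → Matrix (Fin n) (Fin n) ℝ) (V : Eucl n → Fin n → ℝ)
    {φ ψ q : ℝ → ℝ} (hφ : ∀ t, HasDerivAt φ (ψ t) t) (hψ : ∀ t, HasDerivAt ψ (q t) t)
    {U : Eucl n → ℝ} {W : Set (Eucl n)} (hW : IsOpen W) (hU : ContDiffOn ℝ 2 U W)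
    {f : Eucl n → ℝ} (hf : ∀ x ∈ W, f x = φ (U x)) {x : Eucl n} (hx : x ∈ W) :
    Lop a V f x = ψ (U x) * Lop a V U x + q (U x) * aQuad a U x := by
  have hd : ∀ y ∈ W, DifferentiableAt ℝ U y := fun y hy =>
    (hU.contDiffAt (hW.mem_nhds hy)).differentiableAt two_ne_zero
  have h1 : ∀ y ∈ W, ∀ i, pd f i y = ψ (U y) * pd U i y := fun y hy i => by
    rw [Filter.EventuallyEq.pd_eq (Filter.mem_of_superset (hW.mem_nhds hy) hf) i,
      pd_comp (hφ _) (hd y hy)]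
  have h2 : ∀ i j, pd2 f i j x =
      ψ (U x) * pd2 U i j x + q (U x) * (pd U i x * pd U j x) := by
    intro i j
    have hj : ContDiffOn ℝ 1 (pd U j) W :=
      (hU.fderiv_of_isOpen hW le_rfl).clm_apply contDiffOn_const
    have hdj : DifferentiableAt ℝ (pd U j) x :=
      (hj.contDiffAt (hW.mem_nhds hx)).differentiableAt one_ne_zero
    have hdψ : DifferentiableAt ℝ (fun y => ψ (U y)) x :=
      ((hψ (U x)).differentiableAt).comp x (hd x hx)
    change pd (pd f j) i x = ψ (U x) * pd (pd U j) i x + _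
    rw [Filter.EventuallyEq.pd_eq (g := fun y => ψ (U y) * pd U j y)
      (Filter.mem_of_superset (hW.mem_nhds hx) fun y hy => h1 y hy j) i, pd,
      fderiv_fun_mul hdψ hdj]
    have := pd_comp (hψ _) (hd x hx) i
    rw [pd] at this
    simp only [_root_.add_apply, _root_.smul_apply, smul_eq_mul, this]
    change _ * pd (pd U j) i x + _ = _
    ring
  simp only [Lop, aQuad, h1 x hx, h2, Finset.mul_sum, mul_add, Finset.sum_add_distrib]
  have e1 : ∀ i j, a x i j * (q (U x) * (pd U i x * pd U j x)) =
      q (U x) * (a x i j * pd U i x * pd U j x) := fun i j => by ring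
  have e2 : ∀ i j, a x i j * (ψ (U x) * pd2 U i j x) = ψ (U x) * (a x i j * pd2 U i j x) :=
    fun i j => by ring
  have e3 : ∀ i, V x i * (ψ (U x) * pd U i x) = ψ (U x) * (V x i * pd U i x) :=
    fun i => by ring
  simp only [e1, e2, e3]
  ring

theorem continuousOn_aQuad {n : ℕ} {a : Eucl n → Matrix (Fin n) (Fin n) ℝ} {U : Eucl n → ℝ}
    {W : Set (Eucl n)} (hW : IsOpen W) (ha : ∀ i j, ContinuousOn (fun x => a x i j) W)
    (hU : ContDiffOn ℝ 2 U W) : ContinuousOn (aQuad a U) W := by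
  have h1 : ∀ j, ContinuousOn (pd U j) W := fun j =>
    (hU.continuousOn_fderiv_of_isOpen hW one_le_two).clm_apply continuousOn_const
  exact continuousOn_finsetSum _ fun i _ => continuousOn_finsetSum _ fun j _ =>
    ((ha i j).mul (h1 i)).mul (h1 j)

theorem contDiff_indicator_comp {n : ℕ} {φ : ℝ → ℝ} (hφ : ContDiff ℝ 2 φ) {U : Eucl n → ℝ}
    {W : Set (Eucl n)} (hW : IsOpen W) (hU : ContDiffOn ℝ 2 U W) {β : ℝ}
    (hK : IsCompact {x ∈ W | U x ≤ β}) (hφβ : ∀ t, β ≤ t → φ t = 0) :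
    ContDiff ℝ 2 (W.indicator fun x => φ (U x)) ∧
      tsupport (W.indicator fun x => φ (U x)) ⊆ {x ∈ W | U x ≤ β} := by
  have h0 : ∀ x, x ∉ {x ∈ W | U x ≤ β} → W.indicator (fun x => φ (U x)) x = 0 := by
    intro x hx
    by_cases hxW : x ∈ W
    · rw [Set.indicator_of_mem hxW, hφβ]
      exact (not_le.1 fun h => hx ⟨hxW, h⟩).le
    · exact Set.indicator_of_notMem hxW _
  refine ⟨contDiff_iff_contDiffAt.2 fun x => ?_,
    closure_minimal (fun x hx => by_contra fun h => hx (h0 x h)) hK.isClosed⟩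
  by_cases hx : x ∈ W
  · refine (hφ.contDiffAt.comp x (hU.contDiffAt (hW.mem_nhds hx))).congr_of_eventuallyEq ?_
    exact Filter.mem_of_superset (hW.mem_nhds hx) fun y hy => Set.indicator_of_mem hy _
  · refine (contDiffAt_const (c := (0 : ℝ))).congr_of_eventuallyEq ?_
    exact Filter.mem_of_superset (hK.isClosed.isOpen_compl.mem_nhds fun h => hx h.1) fun y hy =>
      h0 y hy

/-- Testing stationarity against `φ ∘ U`, where `φ'' = q` and `φ' ≥ 0` vanishes below `α`. -/
theorem integral_comp_mul_aQuad_nonpos {n : ℕ} {W : Set (Eucl n)} (hW : IsOpen W)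
    {a : Eucl n → Matrix (Fin n) (Fin n) ℝ} (ha : ∀ i j, ContinuousOn (fun x => a x i j) W)
    {V : Eucl n → Fin n → ℝ} (hV : ContinuousOn V W) {u : Eucl n → ℝ} (hu : ContinuousOn u W)
    (hu0 : ∀ x ∈ W, 0 ≤ u x)
    (hstat : ∀ f : Eucl n → ℝ, ContDiff ℝ (⊤ : ℕ∞) f → HasCompactSupport f →
      tsupport f ⊆ W → (∫ x in W, Lop a V f x * u x) = 0)
    {U : Eucl n → ℝ} (hU : ContDiffOn ℝ 2 U W) {α β : ℝ}
    (hK : IsCompact {x ∈ W | U x ≤ β}) (hL : ∀ x ∈ W, α < U x → 0 ≤ Lop a V U x)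
    {q : ℝ → ℝ} (hq : Continuous q) (hqα : ∀ t ≤ α, q t = 0) (hqβ : ∀ t, β ≤ t → q t = 0)
    (hq0 : ∀ t, α ≤ t → t ≤ β → 0 ≤ ∫ s in α..t, q s) (hz : ∫ s in α..β, q s = 0) :
    ∫ x in W, q (U x) * (aQuad a U x * u x) ≤ 0 := by
  set ψ : ℝ → ℝ := fun t => ∫ s in α..t, q s with hψdef
  set φ : ℝ → ℝ := fun t => ∫ s in β..t, ψ s with hφdef
  have hψ : ∀ t, HasDerivAt ψ (q t) t := fun t => hq.integral_hasStrictDerivAt α t |>.hasDerivAt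
  have hψc : Continuous ψ := continuous_iff_continuousAt.2 fun t => (hψ t).continuousAt
  have hφ : ∀ t, HasDerivAt φ (ψ t) t := fun t =>
    hψc.integral_hasStrictDerivAt β t |>.hasDerivAt
  have hψα : ∀ t ≤ α, ψ t = 0 := fun t ht => by
    refine (intervalIntegral.integral_congr fun s hs => ?_).trans intervalIntegral.integral_zero
    rw [Set.uIcc_of_ge ht] at hs
    exact hqα s hs.2
  have hψβ : ∀ t, β ≤ t → ψ t = 0 := fun t ht => by
    change ∫ s in α..t, q s = 0
    rw [← intervalIntegral.integral_add_adjacent_intervals (hq.intervalIntegrable α β)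
      (hq.intervalIntegrable β t), hz, zero_add]
    refine (intervalIntegral.integral_congr fun s hs => ?_).trans intervalIntegral.integral_zero
    rw [Set.uIcc_of_le ht] at hs
    exact hqβ s hs.1
  have hψ0 : ∀ t, 0 ≤ ψ t := fun t => by
    rcases le_total t α with h | h
    · exact (hψα t h).ge
    rcases le_total t β with h' | h'
    · exact hq0 t h h'
    · exact (hψβ t h').ge
  have hφβ : ∀ t, β ≤ t → φ t = 0 := fun t ht => by
    refine (intervalIntegral.integral_congr fun s hs => ?_).trans intervalIntegral.integral_zero
    rw [Set.uIcc_of_le ht] at hs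
    exact hψβ s hs.1
  obtain ⟨hf, hfK⟩ := contDiff_indicator_comp (contDiff_two_of_hasDerivAt hφ hψ hq) hW hU hK hφβ
  have h0 := integral_Lop_mul_eq_zero hW ha hV hu hstat hf
    (hK.of_isClosed_subset (isClosed_tsupport _) hfK) (hfK.trans fun x hx => hx.1)
  have hKW : {x ∈ W | U x ≤ β} ⊆ W := fun x hx => hx.1
  have hi1 : IntegrableOn (fun x => ψ (U x) * (Lop a V U x * u x)) W :=
    ContinuousOn.integrableOn_of_eq_zero hW.measurableSet
      ((hψc.comp_continuousOn hU.continuousOn).mul ((continuousOn_Lop hW ha hV hU).mul hu)) hK hKW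
      fun x hxW hx => by rw [hψβ _ (not_le.1 fun h => hx ⟨hxW, h⟩).le, zero_mul]
  have hi2 : IntegrableOn (fun x => q (U x) * (aQuad a U x * u x)) W :=
    ContinuousOn.integrableOn_of_eq_zero hW.measurableSet
      ((hq.comp_continuousOn hU.continuousOn).mul ((continuousOn_aQuad hW ha hU).mul hu)) hK hKW
      fun x hxW hx => by rw [hqβ _ (not_le.1 fun h => hx ⟨hxW, h⟩).le, zero_mul]
  have h1 : 0 ≤ ∫ x in W, ψ (U x) * (Lop a V U x * u x) :=
    setIntegral_nonneg hW.measurableSet fun x hx => by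
      rcases le_or_gt (U x) α with h | h
      · rw [hψα _ h, zero_mul]
      · exact mul_nonneg (hψ0 _) (mul_nonneg (hL x hx h) (hu0 x hx))
  rw [setIntegral_congr_fun hW.measurableSet fun x hx => by
    rw [Lop_comp a V hφ hψ hW hU (fun x hx => Set.indicator_of_mem hx _) hx, add_mul, mul_assoc,
      mul_assoc], integral_add hi1 hi2] at h0
  linarith

theorem integral_profile_mul_le {n : ℕ} {W : Set (Eucl n)} (hW : IsOpen W) {U w : Eucl n → ℝ}
    (hU : ContinuousOn U W) (hw : ContinuousOn w W) {α ρ β : ℝ} (hαρ : α ≤ ρ) (hρβ : ρ ≤ β)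
    (hK : IsCompact {x ∈ W | U x ≤ β})
    (hneg : ∀ q : ℝ → ℝ, Continuous q → (∀ t ≤ α, q t = 0) → (∀ t, β ≤ t → q t = 0) →
      (∀ t, α ≤ t → t ≤ β → 0 ≤ ∫ s in α..t, q s) → ∫ s in α..β, q s = 0 →
      ∫ x in W, q (U x) * w x ≤ 0)
    {p τ : ℝ → ℝ} (hp : Continuous p) (hp0 : ∀ t, 0 ≤ p t) (hpα : ∀ t ≤ α, p t = 0)
    (hpρ : ∀ t, ρ ≤ t → p t = 0) (hτ : Continuous τ) (hτ0 : ∀ t, 0 ≤ τ t)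
    (hτρ : ∀ t ≤ ρ, τ t = 0) (hτβ : ∀ t, β ≤ t → τ t = 0) :
    (∫ t in ρ..β, τ t) * ∫ x in W, p (U x) * w x ≤
      (∫ t in α..ρ, p t) * ∫ x in W, τ (U x) * w x := by
  set T := ∫ t in ρ..β, τ t
  set B := ∫ t in α..ρ, p t
  have hT : 0 ≤ T := intervalIntegral.integral_nonneg hρβ fun t _ => hτ0 t
  have hB : 0 ≤ B := intervalIntegral.integral_nonneg hαρ fun t _ => hp0 t
  have hqc : Continuous fun t => T * p t - B * τ t :=
    (continuous_const.mul hp).sub (continuous_const.mul hτ)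
  have e1 : ∀ t ≤ ρ, ∫ s in α..t, (T * p s - B * τ s) ∂volume = T * ∫ s in α..t, p s := by
    intro t ht
    rw [← intervalIntegral.integral_const_mul]
    refine intervalIntegral.integral_congr fun s hs => ?_
    have : s ≤ ρ := hs.2.trans (max_le hαρ ht)
    simp [hτρ s this]
  have e2 : ∀ t, ρ ≤ t → ∫ s in t..β, (T * p s - B * τ s) ∂volume = -(B * ∫ s in t..β, τ s) := by
    intro t ht
    rw [← intervalIntegral.integral_const_mul, ← intervalIntegral.integral_neg]
    refine intervalIntegral.integral_congr fun s hs => ?_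
    have : ρ ≤ s := (le_min ht hρβ).trans hs.1
    simp [hpρ s this]
  have hz : ∫ s in α..β, (T * p s - B * τ s) = 0 := by
    rw [← intervalIntegral.integral_add_adjacent_intervals (hqc.intervalIntegrable α ρ)
      (hqc.intervalIntegrable ρ β), e1 ρ le_rfl, e2 ρ le_rfl]
    ring
  have hKW : {x ∈ W | U x ≤ β} ⊆ W := fun x hx => hx.1
  have key := hneg _ hqc (fun t ht => by simp [hpα t ht, hτρ t (ht.trans hαρ)])
    (fun t ht => by simp [hpρ t (hρβ.trans ht), hτβ t ht]) (fun t h1 h2 => by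
      rcases le_total t ρ with h | h
      · rw [e1 t h]
        exact mul_nonneg hT (intervalIntegral.integral_nonneg h1 fun s _ => hp0 s)
      · have := intervalIntegral.integral_add_adjacent_intervals (hqc.intervalIntegrable α t)
          (hqc.intervalIntegrable t β) (μ := volume)
        rw [hz, e2 t h] at this
        have h3 : 0 ≤ B * ∫ s in t..β, τ s :=
          mul_nonneg hB (intervalIntegral.integral_nonneg h2 fun s _ => hτ0 s)
        linarith) hz
  have hi : ∀ r : ℝ → ℝ, Continuous r → (∀ t, β ≤ t → r t = 0) →
      IntegrableOn (fun x => r (U x) * w x) W := fun r hr hrβ =>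
    ContinuousOn.integrableOn_of_eq_zero hW.measurableSet ((hr.comp_continuousOn hU).mul hw) hK hKW
      fun x hxW hx => by rw [hrβ _ (not_le.1 fun h => hx ⟨hxW, h⟩).le, zero_mul]
  simp only [sub_mul, mul_assoc] at key
  rw [integral_sub ((hi p hp fun t ht => hpρ t (hρβ.trans ht)).const_mul T)
    ((hi τ hτ hτβ).const_mul B), integral_const_mul, integral_const_mul] at key
  linarith

/-- Continuous cutoffs increasing to the indicator of `(α, β)`. -/
def cutoff (α β : ℝ) (k : ℕ) (t : ℝ) : ℝ := min 1 (k * max 0 ((t - α) * (β - t)))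

theorem continuous_cutoff (α β : ℝ) (k : ℕ) : Continuous (cutoff α β k) := by
  unfold cutoff
  fun_prop

theorem cutoff_nonneg (α β : ℝ) (k : ℕ) (t : ℝ) : 0 ≤ cutoff α β k t :=
  le_min zero_le_one (by positivity)

theorem cutoff_le_one (α β : ℝ) (k : ℕ) (t : ℝ) : cutoff α β k t ≤ 1 := min_le_left _ _

theorem cutoff_eq_zero {α β : ℝ} (h : α ≤ β) (k : ℕ) {t : ℝ} (ht : t ≤ α ∨ β ≤ t) :
    cutoff α β k t = 0 := by
  have : (t - α) * (β - t) ≤ 0 := by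
    rcases ht with ht | ht <;> nlinarith
  simp [cutoff, max_eq_left this]

theorem tendsto_cutoff {α β : ℝ} (h : α ≤ β) (t : ℝ) :
    Filter.Tendsto (fun k => cutoff α β k t) Filter.atTop
      (nhds ((Set.Ioo α β).indicator (fun _ => (1 : ℝ)) t)) := by
  by_cases ht : t ∈ Set.Ioo α β
  · rw [Set.indicator_of_mem ht]
    have hpos : 0 < (t - α) * (β - t) := mul_pos (sub_pos.2 ht.1) (sub_pos.2 ht.2)
    refine tendsto_const_nhds.congr' ?_
    filter_upwards [(tendsto_natCast_atTop_atTop.atTop_mul_const hpos).eventually_ge_atTop 1]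
      with k hk
    rw [cutoff, max_eq_right hpos.le, min_eq_left hk]
  · rw [Set.indicator_of_notMem ht]
    refine tendsto_const_nhds.congr fun k => (cutoff_eq_zero h k ?_).symm
    by_contra! hc
    exact ht hc

theorem tendsto_integral_cutoff {α β : ℝ} (h : α ≤ β) :
    Filter.Tendsto (fun k => ∫ t in α..β, cutoff α β k t) Filter.atTop (nhds (β - α)) := by
  have : ∫ t in α..β, (Set.Ioo α β).indicator (fun _ => (1 : ℝ)) t = β - α := by
    rw [intervalIntegral.integral_of_le h, integral_Ioc_eq_integral_Ioo,
      setIntegral_congr_fun measurableSet_Ioo fun t ht => Set.indicator_of_mem ht _]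
    simp [h]
  rw [← this]
  refine intervalIntegral.tendsto_integral_filter_of_dominated_convergence (fun _ => 1)
    (Filter.Eventually.of_forall fun k => (continuous_cutoff α β k).aestronglyMeasurable)
    (Filter.Eventually.of_forall fun k => Filter.Eventually.of_forall fun t _ => ?_)
    intervalIntegrable_const (Filter.Eventually.of_forall fun t _ => tendsto_cutoff h t)
  rw [Real.norm_of_nonneg (cutoff_nonneg _ _ _ _)]
  exact cutoff_le_one _ _ _ _

theorem tendsto_setIntegral_cutoff_comp {n : ℕ} {W : Set (Eucl n)} (hW : IsOpen W)
    {U u : Eucl n → ℝ} (hU : ContinuousOn U W) (hu : IntegrableOn u W) {α β : ℝ} (h : α ≤ β) :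
    Filter.Tendsto (fun k => ∫ x in W, cutoff α β k (U x) * u x) Filter.atTop
      (nhds (∫ x in {x ∈ W | α < U x ∧ U x < β}, u x)) := by
  have hS : IsOpen {x ∈ W | α < U x ∧ U x < β} := hU.isOpen_inter_preimage hW isOpen_Ioo
  have hsub : {x ∈ W | α < U x ∧ U x < β} ⊆ W := fun x hx => hx.1
  have e : ∫ x in {x ∈ W | α < U x ∧ U x < β}, u x =
      ∫ x in W, (Set.Ioo α β).indicator (fun _ => (1 : ℝ)) (U x) * u x := by
    rw [← Set.inter_eq_self_of_subset_right hsub, ← setIntegral_indicator hS.measurableSet]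
    refine setIntegral_congr_fun hW.measurableSet fun x hx => ?_
    by_cases hx' : U x ∈ Set.Ioo α β
    · have hxS : x ∈ {x ∈ W | α < U x ∧ U x < β} := ⟨hx, hx'⟩
      rw [Set.indicator_of_mem hx', one_mul, Set.indicator_of_mem hxS]
    · have hxS : x ∉ {x ∈ W | α < U x ∧ U x < β} := fun h => hx' h.2
      rw [Set.indicator_of_notMem hx', zero_mul, Set.indicator_of_notMem hxS]
  rw [e]
  refine tendsto_integral_of_dominated_convergence (fun x => ‖u x‖)
    (fun k => (((continuous_cutoff α β k).comp_continuousOn hU).aestronglyMeasurable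
      hW.measurableSet).mul hu.aestronglyMeasurable) hu.norm
    (fun k => Filter.Eventually.of_forall fun x => ?_)
    (Filter.Eventually.of_forall fun x => (tendsto_cutoff h (U x)).mul_const _)
  rw [norm_mul, Real.norm_of_nonneg (cutoff_nonneg _ _ _ _)]
  exact mul_le_of_le_one_left (norm_nonneg _) (cutoff_le_one _ _ _ _)

theorem mul_setIntegral_le_of_nonpos {n : ℕ} {W : Set (Eucl n)} (hW : IsOpen W)
    {U u w : Eucl n → ℝ} (hU : ContinuousOn U W) (hw : ContinuousOn w W)
    (hw0 : ∀ x ∈ W, 0 ≤ w x) (hu : IntegrableOn u W) {α ρ β : ℝ}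
    (hαρ : α ≤ ρ) (hρβ : ρ ≤ β) (hK : IsCompact {x ∈ W | U x ≤ β})
    (hneg : ∀ q : ℝ → ℝ, Continuous q → (∀ t ≤ α, q t = 0) → (∀ t, β ≤ t → q t = 0) →
      (∀ t, α ≤ t → t ≤ β → 0 ≤ ∫ s in α..t, q s) → ∫ s in α..β, q s = 0 →
      ∫ x in W, q (U x) * w x ≤ 0)
    {g : ℝ → ℝ} (hg : Continuous g) (hg0 : ∀ t, 0 ≤ g t)
    (hgw : ∀ x ∈ W, α < U x → U x < ρ → u x ≤ g (U x) * w x) :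
    (β - ρ) * ∫ x in {x ∈ W | α < U x ∧ U x < ρ}, u x ≤
      (∫ t in α..ρ, g t) * ∫ x in {x ∈ W | ρ ≤ U x ∧ U x < β}, w x := by
  have hSm : MeasurableSet {x ∈ W | ρ ≤ U x ∧ U x < β} :=
    hU.measurableSet_inter_preimage hW.measurableSet measurableSet_Ico
  have hwi : IntegrableOn w {x ∈ W | ρ ≤ U x ∧ U x < β} :=
    ((hw.mono fun x hx => hx.1).integrableOn_compact hK).mono_set fun x hx => ⟨hx.1, hx.2.2.le⟩
  have hA : 0 ≤ ∫ t in α..ρ, g t := intervalIntegral.integral_nonneg hαρ fun t _ => hg0 t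
  refine le_of_tendsto ((tendsto_integral_cutoff hρβ).mul
    (tendsto_setIntegral_cutoff_comp hW hU hu hαρ)) (Filter.Eventually.of_forall fun k => ?_)
  have hT : 0 ≤ ∫ t in ρ..β, cutoff ρ β k t :=
    intervalIntegral.integral_nonneg hρβ fun t _ => cutoff_nonneg _ _ _ _
  have hp : Continuous fun t => cutoff α ρ k t * g t := (continuous_cutoff α ρ k).mul hg
  have hKW : {x ∈ W | U x ≤ β} ⊆ W := fun x hx => hx.1
  have hi : ∀ r : ℝ → ℝ, Continuous r → (∀ t, β ≤ t → r t = 0) →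
      IntegrableOn (fun x => r (U x) * w x) W := fun r hr hrβ =>
    ContinuousOn.integrableOn_of_eq_zero hW.measurableSet ((hr.comp_continuousOn hU).mul hw) hK hKW
      fun x hxW hx => by rw [hrβ _ (not_le.1 fun h => hx ⟨hxW, h⟩).le, zero_mul]
  calc (∫ t in ρ..β, cutoff ρ β k t) * ∫ x in W, cutoff α ρ k (U x) * u x
      ≤ (∫ t in ρ..β, cutoff ρ β k t) * ∫ x in W, cutoff α ρ k (U x) * g (U x) * w x := by
        refine mul_le_mul_of_nonneg_left (setIntegral_mono_on ?_ ?_ hW.measurableSet ?_) hT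
        · refine Integrable.mono hu ((((continuous_cutoff α ρ k).comp_continuousOn
            hU).aestronglyMeasurable hW.measurableSet).mul hu.aestronglyMeasurable)
            (Filter.Eventually.of_forall fun x => ?_)
          rw [norm_mul, Real.norm_of_nonneg (cutoff_nonneg _ _ _ _)]
          exact mul_le_of_le_one_left (norm_nonneg _) (cutoff_le_one _ _ _ _)
        · exact hi _ hp fun t ht => by
            simp [cutoff_eq_zero hαρ k (Or.inr (hρβ.trans ht))]
        · intro x hx
          by_cases h : α < U x ∧ U x < ρ
          · rw [mul_assoc]
            exact mul_le_mul_of_nonneg_left (hgw x hx h.1 h.2) (cutoff_nonneg _ _ _ _)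
          · have : U x ≤ α ∨ ρ ≤ U x := by
              by_contra! hc
              exact h hc
            simp [cutoff_eq_zero hαρ k this]
    _ ≤ (∫ t in α..ρ, cutoff α ρ k t * g t) * ∫ x in W, cutoff ρ β k (U x) * w x :=
        integral_profile_mul_le hW hU hw hαρ hρβ hK hneg hp
          (fun t => mul_nonneg (cutoff_nonneg _ _ _ _) (hg0 t))
          (fun t ht => by simp [cutoff_eq_zero hαρ k (Or.inl ht)])
          (fun t ht => by simp [cutoff_eq_zero hαρ k (Or.inr ht)])
          (continuous_cutoff ρ β k) (cutoff_nonneg ρ β k)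
          (fun t ht => cutoff_eq_zero hρβ k (Or.inl ht))
          (fun t ht => cutoff_eq_zero hρβ k (Or.inr ht))
    _ ≤ (∫ t in α..ρ, g t) * ∫ x in {x ∈ W | ρ ≤ U x ∧ U x < β}, w x := by
        refine mul_le_mul (intervalIntegral.integral_mono_on hαρ (hp.intervalIntegrable _ _)
          (hg.intervalIntegrable _ _) fun t _ =>
            mul_le_of_le_one_left (hg0 t) (cutoff_le_one _ _ _ _)) ?_
          (setIntegral_nonneg hW.measurableSet fun x hx =>
            mul_nonneg (cutoff_nonneg _ _ _ _) (hw0 x hx)) hA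
        rw [← Set.inter_eq_self_of_subset_right (show {x ∈ W | ρ ≤ U x ∧ U x < β} ⊆ W from
          fun x hx => hx.1), ← setIntegral_indicator hSm]
        refine setIntegral_mono_on (hi _ (continuous_cutoff ρ β k) fun t ht =>
          cutoff_eq_zero hρβ k (Or.inr ht)) (hwi.integrable_indicator hSm).integrableOn
          hW.measurableSet fun x hx => ?_
        by_cases h : ρ ≤ U x ∧ U x < β
        · rw [Set.indicator_of_mem (show x ∈ {x ∈ W | ρ ≤ U x ∧ U x < β} from ⟨hx, h⟩)]
          exact mul_le_of_le_one_left (hw0 x hx) (cutoff_le_one _ _ _ _)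
        · have : U x ≤ ρ ∨ β ≤ U x := by
            by_contra! hc
            exact h ⟨hc.1.le, hc.2⟩
          rw [cutoff_eq_zero hρβ k this, zero_mul]
          exact Set.indicator_nonneg (fun y hy => hw0 y hy.1) x

theorem setIntegral_levelSet_nonpos {k : ℕ} {U f : Eucl (k + 1) → ℝ} {W : Set (Eucl (k + 1))}
    (hW : IsOpen W) (hU : ContDiffOn ℝ 1 U W) {ρ ρ₁ : ℝ} (hρ : ρ < ρ₁)
    (hK : IsCompact {x ∈ W | ρ ≤ U x ∧ U x ≤ ρ₁})
    (hreg : ∀ x ∈ W, ρ ≤ U x → U x ≤ ρ₁ → fderiv ℝ U x ≠ 0) (hf : ContinuousOn f W)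
    (hf0 : ∀ x ∈ W, 0 ≤ f x) : ∫ x in {x ∈ W | U x = ρ}, f x ≤ 0 := by
  have hev := (eventually_integral_slab_le hW hU hρ hK hreg hf hf0).2 1 one_pos
  set C := ∫ x in {x ∈ W | U x = ρ}, f x / ‖fderiv ℝ U x‖ ∂μH[(k : ℝ)] + 1
  have hlim : Filter.Tendsto (fun ε : ℝ => ε * C) (nhdsWithin 0 (Set.Ioi 0)) (nhds 0) :=
    (Continuous.tendsto' (by fun_prop) _ _ (by simp)).mono_left nhdsWithin_le_nhds
  have hsmall : ∀ᶠ ε in nhdsWithin (0 : ℝ) (Set.Ioi 0), ε ≤ ρ₁ - ρ :=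
    nhdsWithin_le_nhds (eventually_le_nhds (sub_pos.2 hρ))
  refine ge_of_tendsto hlim ?_
  filter_upwards [hev, hsmall, self_mem_nhdsWithin] with ε hε hερ hε0
  have hε0 : 0 < ε := hε0
  have hm : MeasurableSet {x ∈ W | ρ ≤ U x ∧ U x < ρ + ε} :=
    hU.continuousOn.measurableSet_inter_preimage hW.measurableSet measurableSet_Ico
  refine le_trans (setIntegral_mono_set ?_ ?_ ?_) hε
  · exact ((hf.mono fun x hx => hx.1).integrableOn_compact hK).mono_set
      fun x hx => ⟨hx.1, hx.2.1, by linarith [hx.2.2]⟩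
  · exact (ae_restrict_iff' hm).2 (Filter.Eventually.of_forall fun x hx => hf0 x hx.1)
  · exact LE.le.eventuallyLE fun x hx => ⟨hx.1, hx.2.ge, by linarith [hx.2.le]⟩

/-- Key level-set inequality in the proof of Theorem B(b). -/
theorem levelset_Bb
    {n : ℕ} (hn : 0 < n)
    (𝒰 : Set (Eucl n)) (hUopen : IsOpen 𝒰) (hUconn : IsConnected 𝒰)
    (a : Eucl n → Matrix (Fin n) (Fin n) ℝ)
    (ha_C1 : ∀ i j, ContDiffOn ℝ 1 (fun x => a x i j) 𝒰)
    (ha_symm : ∀ x ∈ 𝒰, ∀ i j, a x i j = a x j i)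
    (ha_psd : ∀ x ∈ 𝒰, ∀ v : Fin n → ℝ, 0 ≤ ∑ i, ∑ j, a x i j * v i * v j)
    (V : Eucl n → Fin n → ℝ) (hV_cont : ContinuousOn V 𝒰)
    (u : Eucl n → ℝ) (hu_C1 : ContDiffOn ℝ 1 u 𝒰) (hu_nonneg : ∀ x ∈ 𝒰, 0 ≤ u x)
    (hu_mass : (∫ x in 𝒰, u x) = 1)
    (hu_stat : ∀ f : Eucl n → ℝ, ContDiff ℝ (⊤ : ℕ∞) f → HasCompactSupport f →
      tsupport f ⊆ 𝒰 → (∫ x in 𝒰, Lop a V f x * u x) = 0)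
    (U : Eucl n → ℝ) (ρM : EReal) (hU_C2 : ContDiffOn ℝ 2 U 𝒰)
    (hU_nonneg : ∀ x ∈ 𝒰, 0 ≤ U x)
    (hU_lt : ∀ x ∈ 𝒰, (U x : EReal) < ρM)
    (hU_sup : ρM = ⨆ x : 𝒰, (U x.1 : EReal))
    (hU_cpt : ∀ ρ : ℝ, (ρ : EReal) < ρM → IsCompact {x ∈ 𝒰 | U x ≤ ρ})
    (ρm : ℝ) (hρm_pos : 0 < ρm) (hρm_lt : (ρm : EReal) < ρM)
    (hWAnti : ∀ x ∈ 𝒰, x ∉ closure {y ∈ 𝒰 | U y < ρm} → 0 ≤ Lop a V U x)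
    (h : ℝ → ℝ) (hh_meas : Measurable h)
    (hh_nonneg : ∀ t : ℝ, 0 ≤ t → (t : EReal) < ρM → 0 ≤ h t)
    (hh_locbdd : ∀ ρ : ℝ, (ρ : EReal) < ρM → BddAbove (h '' Set.Icc 0 ρ))
    (hh_low : ∀ x ∈ 𝒰, h (U x) ≤ aQuad a U x)
    (H : ℝ → ℝ) (hH_meas : Measurable H)
    (hH_nonneg : ∀ t : ℝ, 0 ≤ t → (t : EReal) < ρM → 0 ≤ H t)
    (hH_locbdd : ∀ ρ : ℝ, (ρ : EReal) < ρM → BddAbove (H '' Set.Icc 0 ρ))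
    (hH_up : ∀ x ∈ 𝒰, aQuad a U x ≤ H (U x))
    (hh_pos : ∀ t : ℝ, ρm ≤ t → (t : EReal) < ρM → 0 < h t)
    (hh_cont : ContinuousOn h {t : ℝ | ρm ≤ t ∧ (t : EReal) < ρM}) :
    ∀ ρ : ℝ, ρm < ρ → (ρ : EReal) < ρM →
      (∫ x in {x ∈ 𝒰 | ρm ≤ U x ∧ U x < ρ}, u x) ≤
        (H ρ * ∫ s in ρm..ρ, 1 / h s) *
          ∫ x in {x ∈ 𝒰 | U x = ρ}, u x / ‖gradient U x‖ ∂μH[(n : ℝ) - 1] := by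
  intro ρ hρ hρM
  obtain ⟨k, rfl⟩ : ∃ k, n = k + 1 := Nat.exists_eq_add_one.2 hn
  obtain ⟨ρ₁, hρρ₁, hρ₁M⟩ := EReal.lt_iff_exists_real_btwn.1 hρM
  have hρρ₁ : ρ < ρ₁ := EReal.coe_lt_coe_iff.1 hρρ₁
  have hlt : ∀ {t : ℝ}, t ≤ ρ₁ → (t : EReal) < ρM := fun ht =>
    (EReal.coe_le_coe_iff.2 ht).trans_lt hρ₁M
  have ha : ∀ i j, ContinuousOn (fun x => a x i j) 𝒰 := fun i j => (ha_C1 i j).continuousOn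
  have hUc := hU_C2.continuousOn
  have hU1 : ContDiffOn ℝ 1 U 𝒰 := hU_C2.of_le one_le_two
  have huc := hu_C1.continuousOn
  have hui : IntegrableOn u 𝒰 := Integrable.of_integral_ne_zero (by rw [hu_mass]; exact one_ne_zero)
  have hQ0 : ∀ x ∈ 𝒰, 0 ≤ aQuad a U x := fun x hx => ha_psd x hx fun i => pd U i x
  have hwc : ContinuousOn (fun x => aQuad a U x * u x) 𝒰 :=
    (continuousOn_aQuad hUopen ha hU_C2).mul huc
  have hw0 : ∀ x ∈ 𝒰, 0 ≤ aQuad a U x * u x := fun x hx => mul_nonneg (hQ0 x hx) (hu_nonneg x hx)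
  have hreg : ∀ x ∈ 𝒰, ρm ≤ U x → fderiv ℝ U x ≠ 0 := fun x hx hxm h0 => by
    have h1 := (hh_pos _ hxm (hU_lt x hx)).trans_le (hh_low x hx)
    simp [aQuad, pd, h0] at h1
  have hK : ∀ r, IsCompact {x ∈ 𝒰 | r ≤ U x ∧ U x ≤ ρ₁} := fun r => by
    have hc := hU_cpt ρ₁ hρ₁M
    refine hc.of_isClosed_subset ?_ fun x hx => ⟨hx.1, hx.2.2⟩
    have := (hUc.mono fun x hx => hx.1).preimage_isClosed_of_isClosed hc.isClosed
      (isClosed_Ici (a := r))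
    have e : {x ∈ 𝒰 | r ≤ U x ∧ U x ≤ ρ₁} = {x ∈ 𝒰 | U x ≤ ρ₁} ∩ U ⁻¹' Set.Ici r :=
      Set.ext fun x => ⟨fun h => ⟨⟨h.1, h.2.2⟩, h.2.1⟩, fun h => ⟨h.1.1, h.2, h.1.2⟩⟩
    rwa [e]
  obtain ⟨hfin, hev⟩ := eventually_integral_slab_le hUopen hU1 hρρ₁ (hK ρ)
    (fun x hx h1 _ => hreg x hx (hρ.le.trans h1)) hwc hw0
  have hint : ∀ f : Eucl (k + 1) → ℝ, ContinuousOn f 𝒰 →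
      IntegrableOn (fun x => f x / ‖fderiv ℝ U x‖) {x ∈ 𝒰 | U x = ρ} μH[(k : ℝ)] := fun f hf =>
    integrableOn_div_norm_fderiv_levelSet hUopen hU1 hρρ₁.le (hK ρ)
      (fun x hx h1 _ => hreg x hx (hρ.le.trans h1)) hf hfin
  have hmeas : ∀ {A : Set ℝ}, MeasurableSet A → MeasurableSet (𝒰 ∩ U ⁻¹' A) := fun hA =>
    hUc.measurableSet_inter_preimage hUopen.measurableSet hA
  have hSm : MeasurableSet {x ∈ 𝒰 | U x = ρm} := hmeas (measurableSet_singleton ρm)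
  have hnull : ∫ x in {x ∈ 𝒰 | U x = ρm}, u x ≤ 0 := by
    have h0 := setIntegral_levelSet_nonpos hUopen hU1 (hρ.trans hρρ₁) (hK ρm)
      (fun x hx h1 _ => hreg x hx h1) hwc hw0
    have hle : h ρm * ∫ x in {x ∈ 𝒰 | U x = ρm}, u x ≤
        ∫ x in {x ∈ 𝒰 | U x = ρm}, aQuad a U x * u x := by
      rw [← integral_const_mul]
      refine setIntegral_mono_on ((hui.mono_set fun x hx => hx.1).const_mul _) ?_ hSm
        fun x hx => ?_
      · exact ((hwc.mono fun x hx => hx.1).integrableOn_compact (hK ρm)).mono_set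
          fun x hx => ⟨hx.1, hx.2.ge, hx.2.le.trans (hρ.trans hρρ₁).le⟩
      · have h1 := hh_low x hx.1
        rw [hx.2] at h1
        exact mul_le_mul_of_nonneg_right h1 (hu_nonneg x hx.1)
    exact nonpos_of_mul_nonpos_right (hle.trans h0) (hh_pos ρm le_rfl hρm_lt)
  have hsplit : ∫ x in {x ∈ 𝒰 | ρm ≤ U x ∧ U x < ρ}, u x ≤
      ∫ x in {x ∈ 𝒰 | ρm < U x ∧ U x < ρ}, u x := by
    have e : {x ∈ 𝒰 | ρm ≤ U x ∧ U x < ρ} =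
        {x ∈ 𝒰 | U x = ρm} ∪ {x ∈ 𝒰 | ρm < U x ∧ U x < ρ} := by
      ext x
      constructor
      · rintro ⟨hx, h1, h2⟩
        rcases h1.eq_or_lt with h1 | h1
        exacts [Or.inl ⟨hx, h1.symm⟩, Or.inr ⟨hx, h1, h2⟩]
      · rintro (⟨hx, h1⟩ | ⟨hx, h1, h2⟩)
        exacts [⟨hx, h1.ge, h1.trans_lt hρ⟩, ⟨hx, h1.le, h2⟩]
    have hd : Disjoint {x ∈ 𝒰 | U x = ρm} {x ∈ 𝒰 | ρm < U x ∧ U x < ρ} :=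
      Set.disjoint_left.2 fun x h1 h2 => h2.2.1.ne' h1.2
    rw [e, setIntegral_union hd (hmeas measurableSet_Ioo) (hui.mono_set fun x hx => hx.1)
      (hui.mono_set fun x hx => hx.1)]
    linarith
  set g : ℝ → ℝ := fun t => 1 / h (max ρm (min t ρ))
  have hclamp : ∀ t, ρm ≤ max ρm (min t ρ) ∧ ((max ρm (min t ρ) : ℝ) : EReal) < ρM := fun t =>
    ⟨le_max_left _ _, hlt (max_le (hρ.trans hρρ₁).le ((min_le_right _ _).trans hρρ₁.le))⟩
  have hhc : Continuous fun t => h (max ρm (min t ρ)) :=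
    hh_cont.comp_continuous (by fun_prop) hclamp
  have hhp : ∀ t, 0 < h (max ρm (min t ρ)) := fun t => hh_pos _ (hclamp t).1 (hclamp t).2
  have hg : Continuous g := continuous_const.div hhc fun t => (hhp t).ne'
  have hg0 : ∀ t, 0 ≤ g t := fun t => (one_div_pos.2 (hhp t)).le
  have hgh : ∀ t, ρm ≤ t → t ≤ ρ → g t = 1 / h t := fun t h1 h2 => by
    simp only [g, min_eq_left h2, max_eq_right h1]
  have hA : ∫ t in ρm..ρ, g t = ∫ t in ρm..ρ, 1 / h t :=
    intervalIntegral.integral_congr fun t ht => by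
      rw [Set.uIcc_of_le hρ.le] at ht
      exact hgh t ht.1 ht.2
  have hA0 : 0 ≤ ∫ t in ρm..ρ, 1 / h t :=
    hA ▸ intervalIntegral.integral_nonneg hρ.le fun t _ => hg0 t
  have hgw : ∀ x ∈ 𝒰, ρm < U x → U x < ρ → u x ≤ g (U x) * (aQuad a U x * u x) := by
    intro x hx h1 h2
    rw [hgh _ h1.le h2.le, ← mul_assoc]
    refine le_mul_of_one_le_left (hu_nonneg x hx) ?_
    rw [one_div_mul_eq_div, one_le_div (hh_pos _ h1.le (hU_lt x hx))]
    exact hh_low x hx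
  have hLpos : ∀ x ∈ 𝒰, ρm < U x → 0 ≤ Lop a V U x := by
    refine fun x hx h1 => hWAnti x hx fun hcl => ?_
    obtain ⟨y, hy, hyU⟩ := mem_closure_iff.1 hcl _ (hUc.isOpen_inter_preimage hUopen isOpen_Ioi)
      ⟨hx, h1⟩
    exact hyU.2.not_gt hy.2
  set I := ∫ x in {x ∈ 𝒰 | ρm < U x ∧ U x < ρ}, u x
  set A := ∫ t in ρm..ρ, 1 / h t
  set J := ∫ x in {x ∈ 𝒰 | U x = ρ}, aQuad a U x * u x / ‖fderiv ℝ U x‖ ∂μH[(k : ℝ)]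
  have hIJ : I ≤ A * J := by
    have hθ : ∀ θ > 0, I ≤ A * (J + θ) := by
      intro θ hθ
      have hsmall : ∀ᶠ ε in nhdsWithin (0 : ℝ) (Set.Ioi 0), ε ≤ ρ₁ - ρ :=
        nhdsWithin_le_nhds (eventually_le_nhds (sub_pos.2 hρρ₁))
      obtain ⟨ε, hε, hερ, hε0⟩ := ((hev θ hθ).and (hsmall.and self_mem_nhdsWithin)).exists
      have hε0 : 0 < ε := hε0
      have hKε : IsCompact {x ∈ 𝒰 | U x ≤ ρ + ε} := hU_cpt _ (hlt (by linarith))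
      have := mul_setIntegral_le_of_nonpos hUopen hUc hwc hw0 hui hρ.le
        (le_add_of_nonneg_right hε0.le) hKε (fun q hq hq1 hq2 hq3 hq4 =>
          integral_comp_mul_aQuad_nonpos hUopen ha hV_cont huc hu_nonneg hu_stat hU_C2 hKε hLpos
            hq hq1 hq2 hq3 hq4) hg hg0 hgw
      rw [add_sub_cancel_left, hA] at this
      refine le_of_mul_le_mul_left ?_ hε0
      calc ε * I ≤ A * (ε * (J + θ)) := this.trans (mul_le_mul_of_nonneg_left hε hA0)
        _ = ε * (A * (J + θ)) := by ring
    have hlim : Filter.Tendsto (fun θ : ℝ => A * (J + θ)) (nhdsWithin 0 (Set.Ioi 0))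
        (nhds (A * J)) :=
      (Continuous.tendsto' (by fun_prop) _ _ (by simp)).mono_left nhdsWithin_le_nhds
    exact ge_of_tendsto hlim (Filter.mem_of_superset self_mem_nhdsWithin hθ)
  have hJ : J ≤ H ρ * ∫ x in {x ∈ 𝒰 | U x = ρ}, u x / ‖fderiv ℝ U x‖ ∂μH[(k : ℝ)] := by
    rw [← integral_const_mul]
    refine setIntegral_mono_on (hint _ hwc) ((hint _ huc).const_mul _)
      (hmeas (measurableSet_singleton ρ)) fun x hx => ?_
    rw [← mul_div_assoc]
    have h1 := hH_up x hx.1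
    rw [hx.2] at h1
    exact div_le_div_of_nonneg_right (mul_le_mul_of_nonneg_right h1 (hu_nonneg x hx.1))
      (norm_nonneg _)
  have hgrad : ∀ x, ‖gradient U x‖ = ‖fderiv ℝ U x‖ := fun x => by simp [gradient]
  have hdim : ((k + 1 : ℕ) : ℝ) - 1 = k := by push_cast; ring
  simp only [hgrad, hdim]
  calc ∫ x in {x ∈ 𝒰 | ρm ≤ U x ∧ U x < ρ}, u x ≤ A * J := hsplit.trans hIJ
    _ ≤ _ := (mul_le_mul_of_nonneg_left hJ hA0).trans_eq (by ring)
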